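/- Let $\Omega = \{(x,y) \in \mathbb{R}_+^2 : |x-y| \le d\}$ with $d > 0$, and let $-\Delta_0^d$ be the Dirichlet-on-$\{|x-y|=d\}$, Neumann-on-$\{x=0\}\cup\{y=0\}$ Laplacian on $L^2(\Omega)$, defined via the form $q[\varphi] = \int_\Omega |\nabla\varphi|^2$ on $\{\varphi \in H^1(\Omega): \varphi = 0 \text{ on } |x-y|=d\}$. Then $[2\pi^2/d^2, \infty) \subset \sigma_{ess}(-\Delta_0^d)$, and in fact $\sigma_{ess}(-\Delta_0^d) = [\pi^2/2d^2, \infty)$. -/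

import Mathlib

open MeasureTheory Set Filter Real

noncomputable section

/-- The pencil-shaped two-particle configuration space
`Ω = {(x,y) ∈ ℝ₊² : |x-y| ≤ d}`. -/
def pencil (d : ℝ) : Set (ℝ × ℝ) := {p | 0 ≤ p.1 ∧ 0 ≤ p.2 ∧ |p.1 - p.2| ≤ d}

/-- The two-dimensional Laplacian `Δφ = φ_xx + φ_yy`. -/
def lap2 (φ : ℝ × ℝ → ℂ) (p : ℝ × ℝ) : ℂ :=
  deriv (deriv fun t => φ (t, p.2)) p.1 + deriv (deriv fun t => φ (p.1, t)) p.2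

/-- Operator domain of `-Δ₀^d`: (smooth representatives of) functions on `Ω`
with Dirichlet conditions on `{|x-y| = d}` and Neumann conditions on the
coordinate-axis boundary segments, square-integrable together with their
Laplacian. -/
structure PencilDom (d : ℝ) (φ : ℝ × ℝ → ℂ) : Prop where
  smooth : ContDiff ℝ 2 φ
  dirichlet : ∀ p ∈ pencil d, |p.1 - p.2| = d → φ p = 0
  neumannX : ∀ y ∈ Icc (0 : ℝ) d, deriv (fun t => φ (t, y)) 0 = 0
  neumannY : ∀ x ∈ Icc (0 : ℝ) d, deriv (fun t => φ (x, t)) 0 = 0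
  l2 : IntegrableOn (fun p => ‖φ p‖ ^ 2) (pencil d)
  l2lap : IntegrableOn (fun p => ‖lap2 φ p‖ ^ 2) (pencil d)

/-- Weyl-criterion characterization: `μ` belongs to the essential spectrum of
`-Δ₀^d` iff there is a normalized, weakly null sequence in the operator domain
with `‖(-Δ - μ) uₙ‖ → 0`. -/
def InPencilEssSpec (d μ : ℝ) : Prop :=
  ∃ u : ℕ → (ℝ × ℝ → ℂ),
    (∀ n, PencilDom d (u n)) ∧
    (∀ n, (∫ p in pencil d, ‖u n p‖ ^ 2) = 1) ∧
    (∀ g : ℝ × ℝ → ℂ, IntegrableOn (fun p => ‖g p‖ ^ 2) (pencil d) →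
      Tendsto (fun n => ∫ p in pencil d, (starRingEnd ℂ) (g p) * u n p)
        atTop (nhds 0)) ∧
    Tendsto (fun n => ∫ p in pencil d, ‖lap2 (u n) p + (μ : ℂ) * u n p‖ ^ 2)
      atTop (nhds 0)

lemma pen_L1a (f f' : ℝ → ℝ) (hf : ∀ t, HasDerivAt f (f' t) t) (hc : Continuous f')
    (a b κ : ℝ) (hab : a ≤ b) (hκ : 0 ≤ κ) (hκb : κ * (b - a) < π / 2) (hb : f b = 0) :
    κ ^ 2 * (∫ t in a..b, f t ^ 2) ≤ ∫ t in a..b, f' t ^ 2 := by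
  have hfc : Continuous f := continuous_iff_continuousAt.2 fun t => (hf t).continuousAt
  have hcos : ∀ t ∈ Icc a b, 0 < cos (κ * (t - a)) := by
    intro t ht
    apply cos_pos_of_mem_Ioo
    have h1 : κ * (t - a) ≤ κ * (b - a) := mul_le_mul_of_nonneg_left (by linarith [ht.2]) hκ
    have h2 : 0 ≤ κ * (t - a) := mul_nonneg hκ (by linarith [ht.1])
    constructor <;> linarith [pi_pos]
  set g : ℝ → ℝ := fun t => κ * tan (κ * (t - a)) * f t ^ 2 with hg
  set g' : ℝ → ℝ := fun t => κ ^ 2 / cos (κ * (t - a)) ^ 2 * f t ^ 2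
    + κ * tan (κ * (t - a)) * (2 * f t * f' t) with hg'
  have hd : ∀ t ∈ Icc a b, HasDerivAt g (g' t) t := by
    intro t ht
    have h1 : HasDerivAt (fun t : ℝ => κ * (t - a)) κ t := by
      simpa using ((hasDerivAt_id t).sub_const a).const_mul κ
    have h2 := (hasDerivAt_tan (hcos t ht).ne').comp t h1
    have h3 := (h2.const_mul κ).mul ((hf t).pow 2)
    refine h3.congr_deriv ?_
    simp only [hg', Function.comp, Pi.pow_apply]
    push_cast
    ring
  have hcg' : ContinuousOn g' (Icc a b) := by
    have h1 : ContinuousOn (fun t => cos (κ * (t - a))) (Icc a b) := by fun_prop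
    have h2 : ContinuousOn (fun t => tan (κ * (t - a))) (Icc a b) := by
      simp only [tan_eq_sin_div_cos]
      exact ContinuousOn.div (by fun_prop) h1 fun t ht => (hcos t ht).ne'
    refine ContinuousOn.add (ContinuousOn.mul (ContinuousOn.div continuousOn_const (h1.pow 2) fun t ht => (pow_pos (hcos t ht) 2).ne') (by fun_prop)) (ContinuousOn.mul (h2.const_mul _) (by fun_prop))
  have hii : IntervalIntegrable g' volume a b := by
    apply ContinuousOn.intervalIntegrable; rwa [uIcc_of_le hab]
  have hInt : ∫ t in a..b, g' t = g b - g a :=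
    intervalIntegral.integral_eq_sub_of_hasDerivAt (by rwa [uIcc_of_le hab]) hii
  have hga : g a = 0 := by simp [hg]
  have hgb : g b = 0 := by simp [hg, hb]
  have i1 : IntervalIntegrable (fun t => κ ^ 2 * f t ^ 2) volume a b :=
    (by fun_prop : Continuous (fun t => κ ^ 2 * f t ^ 2)).intervalIntegrable _ _
  have i2 : IntervalIntegrable (fun t => f' t ^ 2) volume a b :=
    (by fun_prop : Continuous (fun t => f' t ^ 2)).intervalIntegrable _ _
  have key : ∫ t in a..b, (κ ^ 2 * f t ^ 2 - g' t) ≤ ∫ t in a..b, f' t ^ 2 := by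
    apply intervalIntegral.integral_mono_on hab (i1.sub hii) i2
    intro t ht
    have hc0 := (hcos t ht).ne'
    have : 1 / cos (κ * (t - a)) ^ 2 = 1 + tan (κ * (t - a)) ^ 2 := by
      rw [tan_eq_sin_div_cos]; field_simp; linarith [sin_sq_add_cos_sq (κ * (t - a))]
    have h2 : g' t = κ ^ 2 * (1 + tan (κ * (t - a)) ^ 2) * f t ^ 2
      + κ * tan (κ * (t - a)) * (2 * f t * f' t) := by
      rw [← this]; simp only [hg']; ring
    rw [h2]
    nlinarith [sq_nonneg (f' t + κ * tan (κ * (t - a)) * f t)]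
  rw [intervalIntegral.integral_sub i1 hii, hInt, hga, hgb, intervalIntegral.integral_const_mul] at key
  linarith

lemma pen_L1 (f f' : ℝ → ℝ) (hf : ∀ t, HasDerivAt f (f' t) t) (hc : Continuous f')
    (a b κ : ℝ) (hab : a ≤ b) (hκ : 0 ≤ κ) (hκb : κ * (b - a) ≤ π / 2) (hb : f b = 0) :
    κ ^ 2 * (∫ t in a..b, f t ^ 2) ≤ ∫ t in a..b, f' t ^ 2 := by
  have hlim : Tendsto (fun r : ℝ => (r * κ) ^ 2 * (∫ t in a..b, f t ^ 2)) (nhdsWithin 1 (Iio 1))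
      (nhds ((1 * κ) ^ 2 * (∫ t in a..b, f t ^ 2))) := by
    apply Tendsto.mono_left _ nhdsWithin_le_nhds
    apply Continuous.tendsto; fun_prop
  rw [one_mul] at hlim
  refine le_of_tendsto hlim ?_
  have h0 : ∀ᶠ r : ℝ in nhdsWithin 1 (Iio 1), 0 < r :=
    nhdsWithin_le_nhds (lt_mem_nhds one_pos)
  filter_upwards [h0, self_mem_nhdsWithin] with r hr hr1
  apply pen_L1a f f' hf hc a b (r * κ) hab (by positivity) _ hb
  have : r < 1 := hr1
  have h3 : 0 ≤ κ * (b - a) := mul_nonneg hκ (by linarith)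
  nlinarith [pi_pos]

lemma pen_L1' (f f' : ℝ → ℝ) (hf : ∀ t, HasDerivAt f (f' t) t) (hc : Continuous f')
    (a b κ : ℝ) (hab : a ≤ b) (hκ : 0 ≤ κ) (hκb : κ * (b - a) ≤ π / 2) (hb : f a = 0) :
    κ ^ 2 * (∫ t in a..b, f t ^ 2) ≤ ∫ t in a..b, f' t ^ 2 := by
  have h := pen_L1 (fun t => f (-t)) (fun t => - f' (-t)) (fun t => by
    simpa [Function.comp_def] using (hf (-t)).comp t (hasDerivAt_neg t)) (by fun_prop) (-b) (-a) κ (by linarith) hκ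
    (by linarith [hκb]) (by simpa using hb)
  simp only [neg_sq] at h
  rw [intervalIntegral.integral_comp_neg (fun t => f t ^ 2),
    intervalIntegral.integral_comp_neg (fun t => f' t ^ 2)] at h
  simpa using h

lemma pen_L2 (f f' : ℝ → ℝ) (hf : ∀ t, HasDerivAt f (f' t) t) (hc : Continuous f')
    (a c b κ : ℝ) (hac : a ≤ c) (hcb : c ≤ b) (hκ : 0 ≤ κ) (h1 : κ * (c - a) ≤ π / 2)
    (h2 : κ * (b - c) ≤ π / 2)
    (ha : f a = 0) (hb : f b = 0) :
    κ ^ 2 * (∫ t in a..b, f t ^ 2) ≤ ∫ t in a..b, f' t ^ 2 := by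
  have hfc : Continuous f := continuous_iff_continuousAt.2 fun t => (hf t).continuousAt
  have e1 := pen_L1' f f' hf hc a c κ hac hκ h1 ha
  have e2 := pen_L1 f f' hf hc c b κ hcb hκ h2 hb
  have i1 : ∀ a b, IntervalIntegrable (fun t => f t ^ 2) volume a b :=
    (by fun_prop : Continuous (fun t => f t ^ 2)).intervalIntegrable
  have i2 : ∀ a b, IntervalIntegrable (fun t => f' t ^ 2) volume a b :=
    (by fun_prop : Continuous (fun t => f' t ^ 2)).intervalIntegrable
  rw [← intervalIntegral.integral_add_adjacent_intervals (i1 a c) (i1 c b),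
    ← intervalIntegral.integral_add_adjacent_intervals (i2 a c) (i2 c b)]
  linarith

lemma pen_L3 (f f' : ℝ → ℝ) (hf : ∀ t, HasDerivAt f (f' t) t) (hc : Continuous f')
    (d : ℝ) (hd : 0 < d) :
    (π / d) ^ 2 * ((∫ t in 0..d, f t ^ 2) - (∫ t in 0..d, f t) ^ 2 / d) ≤ ∫ t in 0..d, f' t ^ 2 := by
  have hfc : Continuous f := continuous_iff_continuousAt.2 fun t => (hf t).continuousAt
  set m := f (d / 2) with hm
  have hF : ∀ t, HasDerivAt (fun t => f t - m) (f' t) t := fun t => (hf t).sub_const m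
  have hk : 0 ≤ π / d := by positivity
  have e1 := pen_L1 _ f' hF hc 0 (d / 2) (π / d) (by positivity) hk (by field_simp; simp) (by simp [hm])
  have e2 := pen_L1' _ f' hF hc (d / 2) d (π / d) (by linarith) hk (by field_simp; linarith) (by simp [hm])
  have i1 : ∀ a b, IntervalIntegrable (fun t => (f t - m) ^ 2) volume a b :=
    (by fun_prop : Continuous (fun t => (f t - m) ^ 2)).intervalIntegrable
  have i2 : ∀ a b, IntervalIntegrable (fun t => f' t ^ 2) volume a b :=
    (by fun_prop : Continuous (fun t => f' t ^ 2)).intervalIntegrable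
  have i3 : IntervalIntegrable (fun t => f t ^ 2) volume 0 d :=
    (by fun_prop : Continuous (fun t => f t ^ 2)).intervalIntegrable _ _
  have i4 : IntervalIntegrable (fun t => 2 * m * f t) volume 0 d :=
    (by fun_prop : Continuous (fun t => 2 * m * f t)).intervalIntegrable _ _
  have e3 : (π / d) ^ 2 * (∫ t in 0..d, (f t - m) ^ 2) ≤ ∫ t in 0..d, f' t ^ 2 := by
    rw [← intervalIntegral.integral_add_adjacent_intervals (i1 0 (d/2)) (i1 (d/2) d),
    ← intervalIntegral.integral_add_adjacent_intervals (i2 0 (d/2)) (i2 (d/2) d)]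
    linarith
  refine le_trans (mul_le_mul_of_nonneg_left ?_ (sq_nonneg _)) e3
  have : ∀ t, (f t - m) ^ 2 = f t ^ 2 - 2 * m * f t + m ^ 2 := fun t => by ring
  simp only [this]
  rw [intervalIntegral.integral_add (i3.sub i4) (by simp), intervalIntegral.integral_sub i3 i4,
    intervalIntegral.integral_const_mul]
  simp only [intervalIntegral.integral_const, smul_eq_mul, sub_zero]
  set I := ∫ t in 0..d, f t
  have : 0 ≤ (I - d * m) ^ 2 / d := by positivity
  have h2 : (I - d * m) ^ 2 / d = I ^ 2 / d - 2 * m * I + d * m ^ 2 := by field_simp; ring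
  linarith

def penQ (d : ℝ) : Set (ℝ × ℝ) := Icc 0 d ×ˢ Icc 0 d

lemma pencil_closed (d : ℝ) : IsClosed (pencil d) := by
  apply IsClosed.inter (isClosed_le continuous_const continuous_fst)
  apply IsClosed.inter (isClosed_le continuous_const continuous_snd)
  exact isClosed_le ((continuous_fst.sub continuous_snd).abs) continuous_const

lemma pencil_meas (d : ℝ) : MeasurableSet (pencil d) := (pencil_closed d).measurableSet

lemma penQ_meas (d : ℝ) : MeasurableSet (penQ d) := measurableSet_Icc.prod measurableSet_Icc

lemma penQ_sub (d : ℝ) : penQ d ⊆ pencil d := by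
  rintro ⟨x, y⟩ ⟨⟨h1, h2⟩, h3, h4⟩
  refine ⟨h1, h3, ?_⟩
  simp only at *
  rw [abs_le]; constructor <;> linarith

lemma pen_intble (d R : ℝ) (g : ℝ × ℝ → ℝ) (hg : Continuous g)
    (h0 : ∀ p : ℝ × ℝ, R < p.1 + p.2 → g p = 0) : IntegrableOn g (pencil d) := by
  have hK : IntegrableOn g (Icc 0 R ×ˢ Icc 0 R) :=
    hg.continuousOn.integrableOn_compact (isCompact_Icc.prod isCompact_Icc)
  refine hK.of_forall_sdiff_eq_zero (pencil_meas d) ?_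
  rintro ⟨x, y⟩ ⟨⟨h1, h2, -⟩, h3⟩
  apply h0
  by_contra h
  apply h3
  simp only [not_lt] at *
  exact ⟨⟨h1, by simp only; linarith⟩, h2, by simp only; linarith⟩

lemma pen_slice_ind (S : Set (ℝ × ℝ)) (hS : MeasurableSet S) (F : ℝ × ℝ → ℝ) (y : ℝ) :
    ∫ x, S.indicator F (x, y) = ∫ x in {x | (x, y) ∈ S}, F (x, y) := by
  have hm : MeasurableSet {x | (x, y) ∈ S} := measurable_prodMk_right hS
  rw [← integral_indicator hm]
  congr 1

lemma pen_fub (S : Set (ℝ × ℝ)) (hS : MeasurableSet S) (F : ℝ × ℝ → ℝ) (hF : IntegrableOn F S) :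
    ∫ p in S, F p = ∫ y, ∫ x in {x | (x, y) ∈ S}, F (x, y) := by
  rw [← integral_indicator hS, Measure.volume_eq_prod, integral_prod_symm]
  · congr 1; ext y
    exact pen_slice_ind S hS F y
  · rw [← Measure.volume_eq_prod]; exact (integrable_indicator_iff hS).2 hF

lemma pen_fub_int (S : Set (ℝ × ℝ)) (hS : MeasurableSet S) (F : ℝ × ℝ → ℝ) (hF : IntegrableOn F S) :
    Integrable fun y => ∫ x in {x | (x, y) ∈ S}, F (x, y) := by
  have h := (integrable_indicator_iff hS).2 hF
  rw [Measure.volume_eq_prod] at h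
  refine h.integral_prod_right.congr (Eventually.of_forall fun y => ?_)
  exact pen_slice_ind S hS F y

lemma pen_fub_mono (S : Set (ℝ × ℝ)) (hS : MeasurableSet S) (F G : ℝ × ℝ → ℝ)
    (hF : IntegrableOn F S) (hG : IntegrableOn G S)
    (h : ∀ y, ∫ x in {x | (x, y) ∈ S}, F (x, y) ≤ ∫ x in {x | (x, y) ∈ S}, G (x, y)) :
    ∫ p in S, F p ≤ ∫ p in S, G p := by
  rw [pen_fub S hS F hF, pen_fub S hS G hG]
  exact integral_mono (pen_fub_int S hS F hF) (pen_fub_int S hS G hG) h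

lemma pen_slice0 (d y : ℝ) (hy : y < 0) : {x | (x, y) ∈ pencil d} = ∅ := by
  ext x; simp only [pencil, mem_ofPred_eq, mem_empty_iff_false, iff_false]
  rintro ⟨-, h, -⟩; linarith
lemma pen_slice1 (d y : ℝ) (hy : 0 ≤ y) (hyd : y ≤ d) : {x | (x, y) ∈ pencil d} = Icc 0 (y + d) := by
  ext x; simp only [pencil, mem_ofPred_eq, mem_Icc, abs_le]
  constructor
  · rintro ⟨h1, h2, h3, h4⟩; constructor <;> linarith
  · rintro ⟨h1, h2⟩; refine ⟨?_, ?_, ?_, ?_⟩ <;> linarith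
lemma pen_slice2 (d y : ℝ) (hd : 0 < d) (hyd : d < y) :
    {x | (x, y) ∈ pencil d} = Icc (y - d) (y + d) := by
  ext x; simp only [pencil, mem_ofPred_eq, mem_Icc, abs_le]
  constructor
  · rintro ⟨h1, h2, h3, h4⟩; constructor <;> linarith
  · rintro ⟨h1, h2⟩; refine ⟨?_, ?_, ?_, ?_⟩ <;> linarith

lemma pen_sliced0 (d y : ℝ) (hy : y < 0) : {x | (x, y) ∈ pencil d \ penQ d} = ∅ := by
  ext x; simp only [pencil, mem_ofPred_eq, mem_empty_iff_false, iff_false, Set.mem_sdiff]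
  rintro ⟨⟨-, h, -⟩, -⟩; linarith
lemma pen_sliced1 (d y : ℝ) (hy : 0 ≤ y) (hyd : y ≤ d) :
    {x | (x, y) ∈ pencil d \ penQ d} = Ioc d (y + d) := by
  ext x; simp only [pencil, penQ, mem_ofPred_eq, mem_Ioc, abs_le, Set.mem_sdiff, mem_prod, mem_Icc]
  constructor
  · rintro ⟨⟨h1, h2, h3, h4⟩, h5⟩
    refine ⟨?_, by linarith⟩
    by_contra h; exact h5 ⟨⟨h1, by linarith⟩, h2, hyd⟩
  · rintro ⟨h1, h2⟩; refine ⟨⟨?_, ?_, ?_, ?_⟩, ?_⟩ <;> try linarith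
    rintro ⟨⟨_, h⟩, _⟩; linarith
lemma pen_sliced2 (d y : ℝ) (hd : 0 < d) (hyd : d < y) :
    {x | (x, y) ∈ pencil d \ penQ d} = Icc (y - d) (y + d) := by
  rw [← pen_slice2 d y hd hyd]
  ext x; simp only [mem_ofPred_eq, Set.mem_sdiff, and_iff_left_iff_imp]
  rintro _ ⟨_, _, h⟩; simp only at h; linarith

lemma pen_H (d R : ℝ) (hd : 0 < d) (ψ ψ1 : ℝ × ℝ → ℝ) (hc : Continuous ψ) (hc1 : Continuous ψ1)
    (h1 : ∀ x y, HasDerivAt (fun t => ψ (t, y)) (ψ1 (x, y)) x)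
    (h0 : ∀ p : ℝ × ℝ, R < p.1 + p.2 → ψ p = 0) (h01 : ∀ p : ℝ × ℝ, R < p.1 + p.2 → ψ1 p = 0)
    (hD : ∀ p ∈ pencil d, |p.1 - p.2| = d → ψ p = 0) :
    (π / (2 * d)) ^ 2 * (∫ p in pencil d \ penQ d, ψ p ^ 2) ≤ ∫ p in pencil d \ penQ d, ψ1 p ^ 2 := by
  rw [← integral_const_mul]
  have hm := (pencil_meas d).diff (penQ_meas d)
  apply pen_fub_mono _ hm
  · exact (pen_intble d R _ (by fun_prop) fun p hp => by simp [h0 p hp]).mono_set sdiff_subset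
  · exact (pen_intble d R _ (by fun_prop) fun p hp => by simp [h01 p hp]).mono_set sdiff_subset
  intro y
  rw [integral_const_mul]
  have hc1' : Continuous fun t => ψ1 (t, y) := by fun_prop
  have hR : ∀ y, 0 ≤ y → ψ (y + d, y) = 0 := fun y hy =>
    hD _ ⟨by simp only; linarith, hy, by simp [abs_of_pos hd]⟩ (by simp [abs_of_pos hd])
  rcases lt_or_ge y 0 with hy | hy
  · rw [pen_sliced0 d y hy]; simp
  rcases le_or_gt y d with hyd | hyd
  · rw [pen_sliced1 d y hy hyd, ← intervalIntegral.integral_of_le (by linarith),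
      ← intervalIntegral.integral_of_le (by linarith)]
    apply pen_L1 _ _ (fun x => h1 x y) hc1' _ _ _ (by linarith) (by positivity) _ (hR y hy)
    have : π / (2 * d) * (y + d - d) = π / 2 * (y / d) := by field_simp; ring
    rw [this]
    have : y / d ≤ 1 := by rw [div_le_one hd]; exact hyd
    nlinarith [pi_pos]
  · rw [pen_sliced2 d y hd hyd, integral_Icc_eq_integral_Ioc, integral_Icc_eq_integral_Ioc,
      ← intervalIntegral.integral_of_le (by linarith),
      ← intervalIntegral.integral_of_le (by linarith)]
    have e : π / (2 * d) * d = π / 2 := by field_simp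
    apply pen_L2 _ _ (fun x => h1 x y) hc1' _ y _ _ (by linarith) (by linarith) (by positivity) 
      (by rw [sub_sub_cancel, e]) (by rw [add_sub_cancel_left, e]) _ (hR y hy)
    exact hD _ ⟨by simp only; linarith, hy, by simp [abs_of_pos hd]⟩ (by simp [abs_of_pos hd])

lemma pen_div (d R : ℝ) (hd : 0 < d) (F F1 : ℝ × ℝ → ℝ) (hc1 : Continuous F1)
    (h1 : ∀ x y, HasDerivAt (fun t => F (t, y)) (F1 (x, y)) x)
    (h01 : ∀ p : ℝ × ℝ, R < p.1 + p.2 → F1 p = 0)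
    (hD : ∀ p ∈ pencil d, |p.1 - p.2| = d → F p = 0)
    (hN : ∀ y ∈ Icc 0 d, F (0, y) = 0) :
    ∫ p in pencil d, F1 p = 0 := by
  rw [pen_fub _ (pencil_meas d) _ (pen_intble d R _ hc1 h01)]
  rw [integral_eq_zero_of_ae]
  refine Eventually.of_forall fun y => ?_
  simp only [Pi.zero_apply]
  have hR : ∀ y, 0 ≤ y → F (y + d, y) = 0 := fun y hy =>
    hD _ ⟨by simp only; linarith, hy, by simp [abs_of_pos hd]⟩ (by simp [abs_of_pos hd])
  have ftc : ∀ a b, ∫ t in a..b, F1 (t, y) = F (b, y) - F (a, y) := fun a b =>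
    intervalIntegral.integral_eq_sub_of_hasDerivAt (fun x _ => h1 x y)
      ((by fun_prop : Continuous fun t => F1 (t, y)).intervalIntegrable _ _)
  rcases lt_or_ge y 0 with hy | hy
  · rw [pen_slice0 d y hy]; simp
  rcases le_or_gt y d with hyd | hyd
  · rw [pen_slice1 d y hy hyd, integral_Icc_eq_integral_Ioc,
      ← intervalIntegral.integral_of_le (by linarith), ftc, hR y hy, hN y ⟨hy, hyd⟩, sub_zero]
  · rw [pen_slice2 d y hd hyd, integral_Icc_eq_integral_Ioc,
      ← intervalIntegral.integral_of_le (by linarith), ftc, hR y hy, hD (y - d, y), sub_zero]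
    · exact ⟨by simp only; linarith, hy, by simp [abs_of_pos hd]⟩ 
    · simp [abs_of_pos hd]

lemma pen_swap (S : Set (ℝ × ℝ)) (hS : ∀ p, Prod.swap p ∈ S ↔ p ∈ S) (F : ℝ × ℝ → ℝ) :
    ∫ p in S, F p.swap = ∫ p in S, F p := by
  have h := (Measure.measurePreserving_swap (μ := (volume : Measure ℝ)) (ν := (volume : Measure ℝ))).setIntegral_preimage_emb
    MeasurableEquiv.prodComm.measurableEmbedding F S
  have e : Prod.swap ⁻¹' S = S := by ext p; exact hS p
  rw [e] at h
  exact h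

lemma pencil_swap (d : ℝ) (p : ℝ × ℝ) : p.swap ∈ pencil d ↔ p ∈ pencil d := by
  simp only [pencil, mem_ofPred_eq, Prod.fst_swap, Prod.snd_swap, abs_sub_comm p.2 p.1]; tauto
lemma penQ_swap (d : ℝ) (p : ℝ × ℝ) : p.swap ∈ penQ d ↔ p ∈ penQ d := by
  simp only [penQ, mem_prod, Prod.fst_swap, Prod.snd_swap]; tauto

def penA (d : ℝ) (ψ : ℝ × ℝ → ℝ) (y : ℝ) : ℝ := (∫ x in Icc 0 d, ψ (x, y)) / d

lemma penA_cont (d : ℝ) (ψ : ℝ × ℝ → ℝ) (hc : Continuous ψ) : Continuous (penA d ψ) := by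
  apply Continuous.div_const
  exact continuous_parametric_integral_of_continuous (f := fun y x => ψ (x, y))
    (by simp only [Function.uncurry_def]; fun_prop) isCompact_Icc

lemma penQ_int (d : ℝ) (ψ : ℝ × ℝ → ℝ) (hc : Continuous ψ) : IntegrableOn ψ (penQ d) :=
  hc.continuousOn.integrableOn_compact (isCompact_Icc.prod isCompact_Icc)

lemma penQ_slice (d y : ℝ) (hy : y ∈ Icc 0 d) : {x | (x, y) ∈ penQ d} = Icc 0 d := by
  ext x; simp only [penQ, mem_ofPred_eq, mem_prod, and_iff_left_iff_imp]; exact fun _ => hy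
lemma penQ_slice' (d y : ℝ) (hy : y ∉ Icc 0 d) : {x | (x, y) ∈ penQ d} = ∅ := by
  ext x; simp only [penQ, mem_ofPred_eq, mem_prod, mem_empty_iff_false, iff_false]
  exact fun h => hy h.2

lemma pen_Icc (d : ℝ) (hd : 0 < d) (f : ℝ → ℝ) : ∫ x in Icc 0 d, f x = ∫ x in 0..d, f x := by
  rw [integral_Icc_eq_integral_Ioc, intervalIntegral.integral_of_le hd.le]

lemma penQ1 (d : ℝ) (hd : 0 < d) (ψ ψ1 : ℝ × ℝ → ℝ) (hc : Continuous ψ) (hc1 : Continuous ψ1)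
    (h1 : ∀ x y, HasDerivAt (fun t => ψ (t, y)) (ψ1 (x, y)) x) :
    (π / d) ^ 2 * ((∫ p in penQ d, ψ p ^ 2) - ∫ p in penQ d, penA d ψ p.2 ^ 2)
      ≤ ∫ p in penQ d, ψ1 p ^ 2 := by
  have ha := penA_cont d ψ hc
  rw [← integral_sub (penQ_int d _ (by fun_prop)) (penQ_int d _ (by fun_prop)),
    ← integral_const_mul]
  apply pen_fub_mono _ (penQ_meas d) _ _ (penQ_int d _ (by fun_prop)) (penQ_int d _ (by fun_prop))
  intro y
  by_cases hy : y ∈ Icc 0 d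
  · rw [penQ_slice d y hy]
    have := pen_L3 _ _ (fun x => h1 x y) (by fun_prop) d hd
    simp only [pen_Icc d hd]
    refine le_trans (le_of_eq ?_) this
    rw [intervalIntegral.integral_const_mul, intervalIntegral.integral_sub
      ((by fun_prop : Continuous fun x => ψ (x, y) ^ 2).intervalIntegrable _ _) (by simp)]
    congr 2
    simp only [penA, pen_Icc d hd, intervalIntegral.integral_const, smul_eq_mul]
    field_simp
    ring
  · rw [penQ_slice' d y hy]; simp

lemma penQA (d : ℝ) (hd : 0 < d) (ψ : ℝ × ℝ → ℝ) (hc : Continuous ψ) :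
    ∫ p in penQ d, ψ p * penA d ψ p.2 = ∫ p in penQ d, penA d ψ p.2 ^ 2 := by
  have ha := penA_cont d ψ hc
  rw [pen_fub _ (penQ_meas d) _ (penQ_int d _ (by fun_prop)),
    pen_fub _ (penQ_meas d) _ (penQ_int d _ (by fun_prop))]
  congr 1; ext y
  by_cases hy : y ∈ Icc 0 d
  · rw [penQ_slice d y hy]
    dsimp only
    rw [integral_mul_const]
    have : ∫ x in Icc 0 d, ψ (x, y) = d * penA d ψ y := by rw [penA]; field_simp
    rw [this, pen_Icc d hd, intervalIntegral.integral_const]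
    simp; ring
  · rw [penQ_slice' d y hy]; simp

lemma penQm (d : ℝ) (ψ : ℝ × ℝ → ℝ) (hc : Continuous ψ) :
    ∫ y in Icc 0 d, penA d ψ y = (∫ p in penQ d, ψ p) / d := by
  rw [pen_fub _ (penQ_meas d) _ (penQ_int d _ hc)]
  simp only [penA]
  rw [integral_div, ← integral_indicator measurableSet_Icc]
  congr 2; ext y
  by_cases hy : y ∈ Icc 0 d
  · rw [penQ_slice d y hy]; simp [hy]
  · rw [penQ_slice' d y hy]; simp [hy]

lemma penQP (d : ℝ) (hd : 0 < d) (ψ ψ1 ψ2 : ℝ × ℝ → ℝ) (hc : Continuous ψ) (hc1 : Continuous ψ1)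
    (hc2 : Continuous ψ2)
    (h1 : ∀ x y, HasDerivAt (fun t => ψ (t, y)) (ψ1 (x, y)) x)
    (h2 : ∀ x y, HasDerivAt (fun t => ψ (x, t)) (ψ2 (x, y)) y) :
    (π / d) ^ 2 * ((∫ p in penQ d, ψ p ^ 2) - 2 * (∫ p in penQ d, ψ p) ^ 2 / d ^ 2) ≤
      (∫ p in penQ d, ψ1 p ^ 2) + ∫ p in penQ d, ψ2 p ^ 2 := by
  set ψs : ℝ × ℝ → ℝ := fun p => ψ p.swap with hs
  have hcs : Continuous ψs := hc.comp continuous_swap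
  have ha := penA_cont d ψ hc
  have hb := penA_cont d ψs hcs
  have e1 := penQ1 d hd ψ ψ1 hc hc1 h1
  have e2 := penQ1 d hd ψs (fun p => ψ2 p.swap) hcs (hc2.comp continuous_swap) (fun x y => h2 y x)
  have s1 := pen_swap (penQ d) (penQ_swap d) (fun p => ψ p ^ 2)
  have s2 := pen_swap (penQ d) (penQ_swap d) (fun p => ψ2 p ^ 2)
  have s3 := pen_swap (penQ d) (penQ_swap d) (fun p => penA d ψs p.1 ^ 2)
  have s4 := pen_swap (penQ d) (penQ_swap d) (fun p => ψ p * penA d ψs p.1)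
  have s5 := pen_swap (penQ d) (penQ_swap d) ψ
  have a1 := penQA d hd ψ hc
  have a2 := penQA d hd ψs hcs
  have m1 := penQm d ψ hc
  have m2 := penQm d ψs hcs
  simp only [hs, Prod.fst_swap] at e2 s1 s2 s3 s4 s5 a2 m2 hb
  rw [s1, s2, s3] at e2
  rw [s4, s3] at a2
  rw [s5] at m2
  have ab : ∫ p in penQ d, penA d (fun p => ψ p.swap) p.1 * penA d ψ p.2 =
      (∫ p in penQ d, ψ p) ^ 2 / d ^ 2 := by
    rw [penQ, Measure.volume_eq_prod, setIntegral_prod_mul, m1, m2, penQ, Measure.volume_eq_prod]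
    ring
  have nn : 0 ≤ ∫ p in penQ d, (ψ p - penA d ψ p.2 - penA d (fun p => ψ p.swap) p.1) ^ 2 :=
    integral_nonneg fun p => sq_nonneg _
  have ex : ∀ p : ℝ × ℝ, (ψ p - penA d ψ p.2 - penA d (fun p => ψ p.swap) p.1) ^ 2 =
    (((ψ p ^ 2 + penA d ψ p.2 ^ 2 + penA d (fun p => ψ p.swap) p.1 ^ 2) - 2 * (ψ p * penA d ψ p.2))
      - 2 * (ψ p * penA d (fun p => ψ p.swap) p.1))
      + 2 * (penA d (fun p => ψ p.swap) p.1 * penA d ψ p.2) := fun p => by ring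
  simp only [ex] at nn
  rw [integral_add (penQ_int d _ (by fun_prop)) (penQ_int d _ (by fun_prop)),
    integral_sub (penQ_int d _ (by fun_prop)) (penQ_int d _ (by fun_prop)),
    integral_sub (penQ_int d _ (by fun_prop)) (penQ_int d _ (by fun_prop)),
    integral_add (penQ_int d _ (by fun_prop)) (penQ_int d _ (by fun_prop)),
    integral_add (penQ_int d _ (by fun_prop)) (penQ_int d _ (by fun_prop)),
    integral_const_mul, integral_const_mul, integral_const_mul, a1, a2, ab] at nn
  have hp : 0 ≤ (π / d) ^ 2 := sq_nonneg _
  have := mul_nonneg hp nn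
  have e3 : 2 * (∫ p in penQ d, ψ p) ^ 2 / d ^ 2 = 2 * ((∫ p in penQ d, ψ p) ^ 2 / d ^ 2) := by ring
  rw [e3]
  nlinarith

lemma penP (d R : ℝ) (hd : 0 < d) (ψ ψ1 ψ2 : ℝ × ℝ → ℝ) (hc : Continuous ψ) (hc1 : Continuous ψ1)
    (hc2 : Continuous ψ2)
    (h1 : ∀ x y, HasDerivAt (fun t => ψ (t, y)) (ψ1 (x, y)) x)
    (h2 : ∀ x y, HasDerivAt (fun t => ψ (x, t)) (ψ2 (x, y)) y)
    (h0 : ∀ p : ℝ × ℝ, R < p.1 + p.2 → ψ p = 0) (h01 : ∀ p : ℝ × ℝ, R < p.1 + p.2 → ψ1 p = 0)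
    (h02 : ∀ p : ℝ × ℝ, R < p.1 + p.2 → ψ2 p = 0)
    (hD : ∀ p ∈ pencil d, |p.1 - p.2| = d → ψ p = 0) :
    π ^ 2 / (2 * d ^ 2) * (∫ p in pencil d, ψ p ^ 2)
      - 2 * π ^ 2 / d ^ 4 * (∫ p in penQ d, ψ p) ^ 2 ≤
    (∫ p in pencil d, ψ1 p ^ 2) + ∫ p in pencil d, ψ2 p ^ 2 := by
  have eQ := penQP d hd ψ ψ1 ψ2 hc hc1 hc2 h1 h2
  have e1 := pen_H d R hd ψ ψ1 hc hc1 h1 h0 h01 hD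
  have e2 := pen_H d R hd (fun p => ψ p.swap) (fun p => ψ2 p.swap) (hc.comp continuous_swap)
    (hc2.comp continuous_swap) (fun x y => h2 y x) (fun p hp => h0 _ (by simpa [add_comm] using hp))
    (fun p hp => h02 _ (by simpa [add_comm] using hp))
    (fun p hp h => hD _ ((pencil_swap d p).2 hp) (by simpa [abs_sub_comm] using h))
  have hsw : ∀ p : ℝ × ℝ, p.swap ∈ pencil d \ penQ d ↔ p ∈ pencil d \ penQ d := fun p => by
    rw [Set.mem_sdiff, Set.mem_sdiff, pencil_swap, penQ_swap]
  rw [pen_swap _ hsw (fun p => ψ p ^ 2), pen_swap _ hsw (fun p => ψ2 p ^ 2)] at e2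
  have split : ∀ g : ℝ × ℝ → ℝ, IntegrableOn g (pencil d) →
      ∫ p in pencil d, g p = (∫ p in penQ d, g p) + ∫ p in pencil d \ penQ d, g p := by
    intro g hg
    rw [setIntegral_sdiff (penQ_meas d) hg (penQ_sub d)]; ring
  rw [split (fun p => ψ p ^ 2) (pen_intble d R _ (by fun_prop) fun p hp => by simp [h0 p hp]),
    split (fun p => ψ1 p ^ 2) (pen_intble d R _ (by fun_prop) fun p hp => by simp [h01 p hp]),
    split (fun p => ψ2 p ^ 2) (pen_intble d R _ (by fun_prop) fun p hp => by simp [h02 p hp])]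
  have hU : 0 ≤ ∫ p in penQ d, ψ p ^ 2 := integral_nonneg fun p => sq_nonneg _
  set U := ∫ p in penQ d, ψ p ^ 2
  set M := ∫ p in penQ d, ψ p
  set V := ∫ p in pencil d \ penQ d, ψ p ^ 2
  have r1 : (π / d) ^ 2 * (U - 2 * M ^ 2 / d ^ 2) =
     π ^ 2 / (2 * d ^ 2) * U + π ^ 2 / (2 * d ^ 2) * U - 2 * π ^ 2 / d ^ 4 * M ^ 2 := by
    field_simp; ring
  have r2 : (π / (2 * d)) ^ 2 * V + (π / (2 * d)) ^ 2 * V = π ^ 2 / (2 * d ^ 2) * V := by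
    field_simp; ring
  have : 0 ≤ π ^ 2 / (2 * d ^ 2) * U := by positivity
  linarith

lemma pen_cutoff : ∃ (χ χ' : ℝ → ℝ) (K : ℝ), Continuous χ' ∧ (∀ t, HasDerivAt χ (χ' t) t) ∧
    (∀ t, 0 ≤ χ t) ∧ (∀ t, χ t ≤ 1) ∧ (∀ t, |t| ≤ 1 → χ t = 1) ∧ (∀ t, 2 < t → χ t = 0) ∧
    (∀ t, 2 < t → χ' t = 0) ∧ ∀ t, |χ' t| ≤ K := by
  let χ : ContDiffBump (0 : ℝ) := ⟨1, 2, one_pos, one_lt_two⟩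
  have hcd : ContDiff ℝ 1 (χ : ℝ → ℝ) := χ.contDiff
  have hc : Continuous (deriv (χ : ℝ → ℝ)) := hcd.continuous_deriv le_rfl
  obtain ⟨K, hK⟩ := hc.bounded_above_of_compact_support χ.hasCompactSupport.deriv
  have hz : ∀ t, 2 < t → χ t = 0 := fun t ht => χ.zero_of_le_dist (by
    rw [Real.dist_0_eq_abs]; exact le_trans ht.le (le_abs_self t))
  refine ⟨χ, deriv χ, K, hc, fun t => (hcd.differentiable one_ne_zero t).hasDerivAt,
    fun t => χ.nonneg, fun t => χ.le_one, fun t ht => χ.one_of_mem_closedBall (by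
      rw [mem_closedBall_zero_iff]; exact ht), hz, ?_, hK⟩
  intro t ht
  have : (χ : ℝ → ℝ) =ᶠ[nhds t] fun _ => 0 := by
    filter_upwards [lt_mem_nhds ht] with s hs using hz s hs
  rw [this.deriv_eq]; simp

lemma pen_cut (d : ℝ) (hd : 0 < d) (w w1 w2 w11 w22 e e' : ℝ × ℝ → ℝ) (R : ℝ)
    (hc1 : Continuous w1) (hc2 : Continuous w2) (hc0 : Continuous w)
    (hc11 : Continuous w11) (hc22 : Continuous w22)
    (h1 : ∀ x y, HasDerivAt (fun t => w (t, y)) (w1 (x, y)) x)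
    (h2 : ∀ x y, HasDerivAt (fun t => w (x, t)) (w2 (x, y)) y)
    (h11 : ∀ x y, HasDerivAt (fun t => w1 (t, y)) (w11 (x, y)) x)
    (h22 : ∀ x y, HasDerivAt (fun t => w2 (x, t)) (w22 (x, y)) y)
    (hD : ∀ p ∈ pencil d, |p.1 - p.2| = d → w p = 0)
    (hN1 : ∀ y ∈ Icc 0 d, w1 (0, y) = 0) (hN2 : ∀ x ∈ Icc 0 d, w2 (x, 0) = 0)
    (ec : Continuous e) (ec' : Continuous e')
    (he1 : ∀ x y, HasDerivAt (fun t => e (t, y)) (e' (x, y)) x)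
    (he2 : ∀ x y, HasDerivAt (fun t => e (x, t)) (e' (x, y)) y)
    (h0 : ∀ p : ℝ × ℝ, R < p.1 + p.2 → e p = 0) (h0' : ∀ p : ℝ × ℝ, R < p.1 + p.2 → e' p = 0) :
    π ^ 2 / (2 * d ^ 2) * (∫ p in pencil d, (e p * w p) ^ 2)
      - 2 * π ^ 2 / d ^ 4 * (∫ p in penQ d, e p * w p) ^ 2 ≤
    2 * (∫ p in pencil d, (e' p * w p) ^ 2)
      + ∫ p in pencil d, e p ^ 2 * (-(w p * (w11 p + w22 p))) := by
  have P := penP d R hd (fun p => e p * w p) (fun p => e' p * w p + e p * w1 p)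
    (fun p => e' p * w p + e p * w2 p) (by fun_prop) (by fun_prop) (by fun_prop)
    (fun x y => (he1 x y).mul (h1 x y)) (fun x y => (he2 x y).mul (h2 x y))
    (fun p hp => by simp [h0 p hp]) (fun p hp => by simp [h0 p hp, h0' p hp])
    (fun p hp => by simp [h0 p hp, h0' p hp]) (fun p hp h => by simp [hD p hp h])
  have D1 := pen_div d R hd (fun p => e p ^ 2 * (w p * w1 p))
    (fun p => 2 * e p * e' p * (w p * w1 p) + e p ^ 2 * (w1 p * w1 p + w p * w11 p)) (by fun_prop)
    (fun x y => by
      have := ((he1 x y).pow 2).mul ((h1 x y).mul (h11 x y))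
      refine this.congr_deriv ?_
      simp)
    (fun p hp => by simp [h0 p hp]) (fun p hp h => by simp [hD p hp h])
    (fun y hy => by simp [hN1 y hy])
  have D2 := pen_div d R hd (fun p => e p.swap ^ 2 * (w p.swap * w2 p.swap))
    (fun p => 2 * e p.swap * e' p.swap * (w p.swap * w2 p.swap) + e p.swap ^ 2 * (w2 p.swap * w2 p.swap + w p.swap * w22 p.swap)) (by fun_prop)
    (fun x y => by
      have := ((he2 y x).pow 2).mul ((h2 y x).mul (h22 y x))
      refine this.congr_deriv ?_
      simp)
    (fun p hp => by simp [h0 p.swap (by simpa [add_comm] using hp)])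
    (fun p hp h => by
      simp [hD p.swap ((pencil_swap d p).2 hp) (by simpa [abs_sub_comm] using h)])
    (fun y hy => by simp [hN2 y hy])
  rw [pen_swap _ (pencil_swap d) (fun p => 2 * e p * e' p * (w p * w2 p) + e p ^ 2 * (w2 p * w2 p + w p * w22 p))] at D2
  refine P.trans (le_of_eq ?_)
  have I : ∀ g : ℝ × ℝ → ℝ, Continuous g → (∀ p : ℝ × ℝ, R < p.1 + p.2 → g p = 0) →
    IntegrableOn g (pencil d) := pen_intble d R
  rw [← integral_add (I _ (by fun_prop) fun p hp => by simp [h0 p hp, h0' p hp])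
    (I _ (by fun_prop) fun p hp => by simp [h0 p hp, h0' p hp]), ← integral_const_mul,
    ← integral_add (I _ (by fun_prop) fun p hp => by simp [h0 p hp, h0' p hp])
    (I _ (by fun_prop) fun p hp => by simp [h0 p hp, h0' p hp])]
  rw [← sub_eq_zero, ← integral_sub (I _ (by fun_prop) fun p hp => by simp [h0 p hp, h0' p hp])
    (I _ (by fun_prop) fun p hp => by simp [h0 p hp, h0' p hp])]
  rw [← add_zero (0 : ℝ)]
  nth_rewrite 1 [← D1]
  rw [← D2, ← integral_add (I _ (by fun_prop) fun p hp => by simp [h0 p hp, h0' p hp])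
    (I _ (by fun_prop) fun p hp => by simp [h0 p hp, h0' p hp])]
  congr 1; ext p
  ring

lemma pen_real (d : ℝ) (hd : 0 < d) (w w1 w2 w11 w22 : ℝ × ℝ → ℝ)
    (hc1 : Continuous w1) (hc2 : Continuous w2) (hc0 : Continuous w)
    (hc11 : Continuous w11) (hc22 : Continuous w22)
    (h1 : ∀ x y, HasDerivAt (fun t => w (t, y)) (w1 (x, y)) x)
    (h2 : ∀ x y, HasDerivAt (fun t => w (x, t)) (w2 (x, y)) y)
    (h11 : ∀ x y, HasDerivAt (fun t => w1 (t, y)) (w11 (x, y)) x)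
    (h22 : ∀ x y, HasDerivAt (fun t => w2 (x, t)) (w22 (x, y)) y)
    (hD : ∀ p ∈ pencil d, |p.1 - p.2| = d → w p = 0)
    (hN1 : ∀ y ∈ Icc 0 d, w1 (0, y) = 0) (hN2 : ∀ x ∈ Icc 0 d, w2 (x, 0) = 0)
    (hi : IntegrableOn (fun p => w p ^ 2) (pencil d))
    (hi2 : IntegrableOn (fun p => w p * (w11 p + w22 p)) (pencil d)) :
    π ^ 2 / (2 * d ^ 2) * (∫ p in pencil d, w p ^ 2)
      - 2 * π ^ 2 / d ^ 4 * (∫ p in penQ d, w p) ^ 2 ≤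
      ∫ p in pencil d, (-(w p * (w11 p + w22 p))) := by
  obtain ⟨χ, χ', K, hcχ', hχ, hχ0, hχ1, hχo, hχz, hχz', hK⟩ := pen_cutoff
  have hcχ : Continuous χ := continuous_iff_continuousAt.2 fun t => (hχ t).continuousAt
  let N : ℕ → ℝ := fun n => (n : ℝ) + 1
  have hN : ∀ n, 0 < N n := fun n => by positivity
  have hNt : Tendsto N atTop atTop := tendsto_atTop_add_const_right _ _ tendsto_natCast_atTop_atTop
  let e : ℕ → ℝ × ℝ → ℝ := fun n p => χ ((p.1 + p.2) / N n)
  let e' : ℕ → ℝ × ℝ → ℝ := fun n p => χ' ((p.1 + p.2) / N n) / N n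
  have hec : ∀ n, Continuous (e n) := fun n => by fun_prop
  have hec' : ∀ n, Continuous (e' n) := fun n => by fun_prop
  have hdd : ∀ n (c x : ℝ), HasDerivAt (fun t => χ ((t + c) / N n)) (χ' ((x + c) / N n) / N n) x := by
    intro n c x
    have := (hχ ((x + c) / N n)).comp x (((hasDerivAt_id x).add_const c).div_const (N n))
    simpa [Function.comp_def, div_eq_mul_inv] using this
  have key : ∀ n, 2 * d ≤ N n → π ^ 2 / (2 * d ^ 2) * (∫ p in pencil d, e n p ^ 2 * w p ^ 2)
      - 2 * π ^ 2 / d ^ 4 * (∫ p in penQ d, w p) ^ 2 ≤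
    2 * (K ^ 2 / N n ^ 2 * (∫ p in pencil d, w p ^ 2))
      + ∫ p in pencil d, e n p ^ 2 * (-(w p * (w11 p + w22 p))) := by
    intro n hn
    have hb : ∀ p : ℝ × ℝ, 2 * N n < p.1 + p.2 → 2 < (p.1 + p.2) / N n := fun p hp => by
      rw [lt_div_iff₀ (hN n)]; exact hp
    have := pen_cut d hd w w1 w2 w11 w22 (e n) (e' n) (2 * N n) hc1 hc2 hc0 hc11 hc22 h1 h2 h11 h22
      hD hN1 hN2 (hec n) (hec' n) (fun x y => hdd n y x)
      (fun x y => by simpa [add_comm, e, e'] using hdd n x y)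
      (fun p hp => hχz _ (hb p hp)) (fun p hp => by simp [e', hχz' _ (hb p hp)])
    have q : ∫ p in penQ d, e n p * w p = ∫ p in penQ d, w p := by
      apply setIntegral_congr_fun (penQ_meas d)
      rintro ⟨x, y⟩ ⟨⟨a1, a2⟩, a3, a4⟩
      simp only at *
      have : e n (x, y) = 1 := by
        apply hχo
        rw [abs_of_nonneg (div_nonneg (by simp only; linarith) (hN n).le), div_le_one (hN n)]
        simp only; linarith
      rw [this, one_mul]
    rw [q] at this
    simp only [mul_pow] at this
    refine this.trans ?_
    gcongr
    rw [← integral_const_mul]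
    apply integral_mono_of_nonneg (Eventually.of_forall fun p => by positivity) (hi.const_mul _)
    refine Eventually.of_forall fun p => ?_
    simp only [e', div_pow]
    have hsq : χ' ((p.1 + p.2) / N n) ^ 2 ≤ K ^ 2 :=
      sq_le_sq' (abs_le.1 (hK ((p.1 + p.2) / N n))).1 (abs_le.1 (hK ((p.1 + p.2) / N n))).2
    exact mul_le_mul_of_nonneg_right (div_le_div_of_nonneg_right hsq (by positivity)) (sq_nonneg _)
  have elim : ∀ p, Tendsto (fun n => e n p ^ 2) atTop (nhds 1) := by
    intro p
    have : Tendsto (fun n => (p.1 + p.2) / N n) atTop (nhds 0) := tendsto_const_nhds.div_atTop hNt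
    have h3 := ((hcχ.tendsto 0).comp this).pow 2
    rw [hχo 0 (by simp), one_pow] at h3
    exact h3
  have dom : ∀ g : ℝ × ℝ → ℝ, IntegrableOn g (pencil d) →
      Tendsto (fun n => ∫ p in pencil d, e n p ^ 2 * g p) atTop (nhds (∫ p in pencil d, g p)) := by
    intro g hg
    apply tendsto_integral_of_dominated_convergence (fun p => ‖g p‖)
    · intro n; exact ((hec n).pow 2).aestronglyMeasurable.mul hg.aestronglyMeasurable
    · exact hg.norm
    · intro n; refine Eventually.of_forall fun p => ?_
      rw [norm_mul, Real.norm_eq_abs, abs_of_nonneg (sq_nonneg _)]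
      exact mul_le_of_le_one_left (norm_nonneg _) (pow_le_one₀ (hχ0 _) (hχ1 _))
    · refine Eventually.of_forall fun p => ?_
      simpa using (elim p).mul_const (g p)
  have kl : Tendsto (fun n => K ^ 2 / N n ^ 2) atTop (nhds 0) :=
    tendsto_const_nhds.div_atTop ((tendsto_pow_atTop two_ne_zero).comp hNt)
  have L := ((dom _ hi).const_mul (π ^ 2 / (2 * d ^ 2))).sub_const
    (2 * π ^ 2 / d ^ 4 * (∫ p in penQ d, w p) ^ 2)
  have Rr := ((kl.mul_const (∫ p in pencil d, w p ^ 2)).const_mul 2).add (dom _ hi2.neg)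
  refine (le_of_tendsto_of_tendsto L Rr ?_).trans (le_of_eq ?_)
  · filter_upwards [hNt.eventually_ge_atTop (2 * d)] with n hn using key n hn
  · simp

lemma pen_part (V : Type*) [NormedAddCommGroup V] [NormedSpace ℝ V] (f : ℝ × ℝ → V) 
    (hf : Differentiable ℝ f) (x y : ℝ) :
    HasDerivAt (fun t => f (t, y)) (fderiv ℝ f (x, y) (1, 0)) x ∧
    HasDerivAt (fun t => f (x, t)) (fderiv ℝ f (x, y) (0, 1)) y := by
  have h := (hf (x, y)).hasFDerivAt
  constructor
  · exact h.comp_hasDerivAt x ((hasDerivAt_id x).prodMk (hasDerivAt_const x y))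
  · exact h.comp_hasDerivAt y ((hasDerivAt_const y x).prodMk (hasDerivAt_id y))

lemma pen_parts (φ : ℝ × ℝ → ℂ) (hφ : ContDiff ℝ 2 φ) :
    ∃ φ1 φ2 φ11 φ22 : ℝ × ℝ → ℂ, Continuous φ1 ∧ Continuous φ2 ∧ Continuous φ11 ∧ Continuous φ22 ∧
    (∀ x y, HasDerivAt (fun t => φ (t, y)) (φ1 (x, y)) x) ∧
    (∀ x y, HasDerivAt (fun t => φ (x, t)) (φ2 (x, y)) y) ∧
    (∀ x y, HasDerivAt (fun t => φ1 (t, y)) (φ11 (x, y)) x) ∧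
    (∀ x y, HasDerivAt (fun t => φ2 (x, t)) (φ22 (x, y)) y) ∧
    lap2 φ = fun p => φ11 p + φ22 p := by
  have hfd : ContDiff ℝ 1 (fderiv ℝ φ) := hφ.fderiv_right (by norm_num)
  have g1 : ContDiff ℝ 1 (fun p => fderiv ℝ φ p (1, 0)) := hfd.clm_apply contDiff_const
  have g2 : ContDiff ℝ 1 (fun p => fderiv ℝ φ p (0, 1)) := hfd.clm_apply contDiff_const
  have a1 := fun x y => (pen_part ℂ φ (hφ.differentiable two_ne_zero) x y).1
  have a2 := fun x y => (pen_part ℂ φ (hφ.differentiable two_ne_zero) x y).2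
  have a11 := fun x y => (pen_part ℂ _ (g1.differentiable one_ne_zero) x y).1
  have a22 := fun x y => (pen_part ℂ _ (g2.differentiable one_ne_zero) x y).2
  refine ⟨_, _, _, _, g1.continuous, g2.continuous, 
    (g1.continuous_fderiv one_ne_zero).clm_apply continuous_const, 
    (g2.continuous_fderiv one_ne_zero).clm_apply continuous_const, a1, a2, a11, a22, ?_⟩
  ext ⟨x, y⟩
  simp only [lap2]
  have e1 : (deriv fun t => φ (t, y)) = fun t => fderiv ℝ φ (t, y) (1, 0) := by
    ext t; exact (a1 t y).deriv
  have e2 : (deriv fun t => φ (x, t)) = fun t => fderiv ℝ φ (x, t) (0, 1) := by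
    ext t; exact (a2 x t).deriv
  rw [e1, e2, (a11 x y).deriv, (a22 x y).deriv]

lemma pen_complex (d : ℝ) (hd : 0 < d) (φ : ℝ × ℝ → ℂ) (h : PencilDom d φ) (μ ε : ℝ) (hε : 0 < ε) :
    π ^ 2 / (2 * d ^ 2) * (∫ p in pencil d, ‖φ p‖ ^ 2)
      - 2 * π ^ 2 / d ^ 4 * ‖∫ p in penQ d, φ p‖ ^ 2 ≤
      (μ + ε) * (∫ p in pencil d, ‖φ p‖ ^ 2) +
      1 / (4 * ε) * ∫ p in pencil d, ‖lap2 φ p + (μ : ℂ) * φ p‖ ^ 2 := by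
  obtain ⟨φ1, φ2, φ11, φ22, c1, c2, c11, c22, h1, h2, h11, h22, hl⟩ := pen_parts φ h.smooth
  have c0 : Continuous φ := h.smooth.continuous
  have hlap := h.l2lap
  have hl2 := h.l2
  rw [hl] at hlap ⊢
  simp only at hlap ⊢
  have hre : ∀ {f : ℝ → ℂ} {f' : ℂ} {x : ℝ}, HasDerivAt f f' x → 
      HasDerivAt (fun t => (f t).re) f'.re x := fun {f f' x} hf =>
    Complex.reCLM.hasFDerivAt.comp_hasDerivAt x hf
  have him : ∀ {f : ℝ → ℂ} {f' : ℂ} {x : ℝ}, HasDerivAt f f' x → 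
      HasDerivAt (fun t => (f t).im) f'.im x := fun {f f' x} hf =>
    Complex.imCLM.hasFDerivAt.comp_hasDerivAt x hf
  have hns : ∀ z : ℂ, ‖z‖ ^ 2 = z.re ^ 2 + z.im ^ 2 := fun z => by
    rw [Complex.sq_norm, Complex.normSq_apply]; ring
  have hN1 : ∀ y ∈ Icc 0 d, φ1 (0, y) = 0 := fun y hy => by
    rw [← (h1 0 y).deriv]; exact h.neumannX y hy
  have hN2 : ∀ x ∈ Icc 0 d, φ2 (x, 0) = 0 := fun x hx => by
    rw [← (h2 x 0).deriv]; exact h.neumannY x hx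
  have ire : IntegrableOn (fun p => (φ p).re ^ 2) (pencil d) := by
    refine Integrable.mono' hl2 (by fun_prop) (Eventually.of_forall fun p => ?_)
    rw [hns, Real.norm_eq_abs, abs_of_nonneg (sq_nonneg _)]; nlinarith [sq_nonneg (φ p).im]
  have iim : IntegrableOn (fun p => (φ p).im ^ 2) (pencil d) := by
    refine Integrable.mono' hl2 (by fun_prop) (Eventually.of_forall fun p => ?_)
    rw [hns, Real.norm_eq_abs, abs_of_nonneg (sq_nonneg _)]; nlinarith [sq_nonneg (φ p).re]
  have jre : IntegrableOn (fun p => (φ p).re * ((φ11 p).re + (φ22 p).re)) (pencil d) := by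
    refine Integrable.mono' (hl2.add hlap) (by fun_prop) (Eventually.of_forall fun p => ?_)
    simp only [Pi.add_apply]
    rw [hns, hns, Real.norm_eq_abs, Complex.add_re, Complex.add_im, abs_le]
    constructor <;> nlinarith [sq_nonneg ((φ p).re + ((φ11 p).re + (φ22 p).re)), sq_nonneg ((φ p).re - ((φ11 p).re + (φ22 p).re)), sq_nonneg (φ p).im, sq_nonneg ((φ11 p).im + (φ22 p).im), sq_nonneg (φ p).re, sq_nonneg ((φ11 p).re + (φ22 p).re)]
  have jim : IntegrableOn (fun p => (φ p).im * ((φ11 p).im + (φ22 p).im)) (pencil d) := by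
    refine Integrable.mono' (hl2.add hlap) (by fun_prop) (Eventually.of_forall fun p => ?_)
    simp only [Pi.add_apply]
    rw [hns, hns, Real.norm_eq_abs, Complex.add_re, Complex.add_im, abs_le]
    constructor <;> nlinarith [sq_nonneg ((φ p).im + ((φ11 p).im + (φ22 p).im)), sq_nonneg ((φ p).im - ((φ11 p).im + (φ22 p).im)), sq_nonneg (φ p).re, sq_nonneg ((φ11 p).re + (φ22 p).re), sq_nonneg (φ p).im, sq_nonneg ((φ11 p).im + (φ22 p).im)]
  have ires : IntegrableOn (fun p => ‖φ11 p + φ22 p + (μ : ℂ) * φ p‖ ^ 2) (pencil d) := by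
    refine Integrable.mono' ((hlap.const_mul 2).add (hl2.const_mul (2 * μ ^ 2))) (by fun_prop)
      (Eventually.of_forall fun p => ?_)
    simp only [Pi.add_apply]
    rw [Real.norm_eq_abs, abs_of_nonneg (sq_nonneg _)]
    have := norm_add_le (φ11 p + φ22 p) ((μ : ℂ) * φ p)
    have h3 : ‖(μ : ℂ) * φ p‖ ^ 2 = μ ^ 2 * ‖φ p‖ ^ 2 := by
      rw [norm_mul, mul_pow, Complex.norm_real, Real.norm_eq_abs, sq_abs]
    have h4 := norm_nonneg (φ11 p + φ22 p + (μ : ℂ) * φ p)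
    nlinarith [sq_nonneg (‖φ11 p + φ22 p‖ - ‖(μ : ℂ) * φ p‖)]
  have A := pen_real d hd (fun p => (φ p).re) (fun p => (φ1 p).re) (fun p => (φ2 p).re)
    (fun p => (φ11 p).re) (fun p => (φ22 p).re) (by fun_prop) (by fun_prop) (by fun_prop)
    (by fun_prop) (by fun_prop) (fun x y => hre (h1 x y)) (fun x y => hre (h2 x y))
    (fun x y => hre (h11 x y)) (fun x y => hre (h22 x y)) 
    (fun p hp hp' => by simp [h.dirichlet p hp hp']) (fun y hy => by simp [hN1 y hy])
    (fun x hx => by simp [hN2 x hx]) ire jre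
  have B := pen_real d hd (fun p => (φ p).im) (fun p => (φ1 p).im) (fun p => (φ2 p).im)
    (fun p => (φ11 p).im) (fun p => (φ22 p).im) (by fun_prop) (by fun_prop) (by fun_prop)
    (by fun_prop) (by fun_prop) (fun x y => him (h1 x y)) (fun x y => him (h2 x y))
    (fun x y => him (h11 x y)) (fun x y => him (h22 x y)) 
    (fun p hp hp' => by simp [h.dirichlet p hp hp']) (fun y hy => by simp [hN1 y hy])
    (fun x hx => by simp [hN2 x hx]) iim jim
  have iQ : IntegrableOn φ (penQ d) := 
    c0.continuousOn.integrableOn_compact (isCompact_Icc.prod isCompact_Icc)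
  have q1 : (∫ p in penQ d, φ p).re = ∫ p in penQ d, (φ p).re :=
    (Complex.reCLM.integral_comp_comm iQ).symm
  have q2 : (∫ p in penQ d, φ p).im = ∫ p in penQ d, (φ p).im :=
    (Complex.imCLM.integral_comp_comm iQ).symm
  have n1 : ∫ p in pencil d, ‖φ p‖ ^ 2 = (∫ p in pencil d, (φ p).re ^ 2) + ∫ p in pencil d, (φ p).im ^ 2 := by
    rw [← integral_add ire iim]; simp only [hns]
  have C : (∫ p in pencil d, -((φ p).re * ((φ11 p).re + (φ22 p).re))) + 
     (∫ p in pencil d, -((φ p).im * ((φ11 p).im + (φ22 p).im))) ≤ 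
      (μ + ε) * (∫ p in pencil d, ‖φ p‖ ^ 2) +
      1 / (4 * ε) * ∫ p in pencil d, ‖φ11 p + φ22 p + (μ : ℂ) * φ p‖ ^ 2 := by
    have kre : IntegrableOn (fun p => -((φ p).re * ((φ11 p).re + (φ22 p).re))) (pencil d) := jre.neg
    have kim : IntegrableOn (fun p => -((φ p).im * ((φ11 p).im + (φ22 p).im))) (pencil d) := jim.neg
    rw [← integral_add kre kim, ← integral_const_mul, ← integral_const_mul, 
      ← integral_add (hl2.const_mul _) (ires.const_mul _)]
    apply integral_mono (kre.add kim) ((hl2.const_mul _).add (ires.const_mul _))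
    intro p
    simp only [Pi.add_apply, Pi.neg_apply, hns, Complex.add_re, Complex.add_im, Complex.re_ofReal_mul,
      Complex.im_ofReal_mul]
    generalize (φ11 p).re + (φ22 p).re = a
    generalize (φ11 p).im + (φ22 p).im = b
    generalize (φ p).re = x
    generalize (φ p).im = y
    have e1 : (μ + ε) * (x ^ 2 + y ^ 2) + 1 / (4 * ε) * ((a + μ * x) ^ 2 + (b + μ * y) ^ 2) 
      - (-(x * a) + -(y * b)) = 
      ((2 * ε * x + (a + μ * x)) ^ 2 + (2 * ε * y + (b + μ * y)) ^ 2) / (4 * ε) := by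
      field_simp; ring
    have e2 : 0 ≤ ((2 * ε * x + (a + μ * x)) ^ 2 + (2 * ε * y + (b + μ * y)) ^ 2) / (4 * ε) := by
      positivity
    linarith
  rw [hns (∫ p in penQ d, φ p), q1, q2]
  refine le_trans ?_ C
  rw [n1]
  linarith

lemma pen_sub (d : ℝ) (hd : 0 < d) (μ : ℝ) (h : InPencilEssSpec d μ) : π ^ 2 / (2 * d ^ 2) ≤ μ := by
  obtain ⟨u, hu, hn, hw, hr⟩ := h
  have hq := hw ((penQ d).indicator 1) (by
    have : (fun p => ‖(penQ d).indicator (1 : ℝ × ℝ → ℂ) p‖ ^ 2) = (penQ d).indicator (fun _ => (1 : ℝ)) := by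
      ext p; by_cases hp : p ∈ penQ d <;> simp [hp]
    rw [this]
    apply Integrable.integrableOn
    rw [integrable_indicator_iff (penQ_meas d)]
    exact penQ_int d _ continuous_const)
  have hq' : Tendsto (fun n => ∫ p in penQ d, u n p) atTop (nhds 0) := by
    refine hq.congr fun n => ?_
    have : (fun p => (starRingEnd ℂ) ((penQ d).indicator 1 p) * u n p) = (penQ d).indicator (u n) := by
      ext p; by_cases hp : p ∈ penQ d <;> simp [hp]
    rw [this, setIntegral_indicator (penQ_meas d), inter_eq_self_of_subset_right (penQ_sub d)]
  apply le_of_forall_pos_le_add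
  intro ε hε
  have L : Tendsto (fun n => π ^ 2 / (2 * d ^ 2) * 1 - 2 * π ^ 2 / d ^ 4 * ‖∫ p in penQ d, u n p‖ ^ 2) 
    atTop (nhds (π ^ 2 / (2 * d ^ 2) * 1 - 2 * π ^ 2 / d ^ 4 * ‖(0 : ℂ)‖ ^ 2)) := 
    ((hq'.norm.pow 2).const_mul _).const_sub _
  have R := (hr.const_mul (1 / (4 * ε))).const_add ((μ + ε) * 1)
  have := le_of_tendsto_of_tendsto' L R (fun n => by
    have := pen_complex d hd (u n) (hu n) μ ε hε
    rw [hn n] at this; exact this)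
  simpa using this

lemma pen_mp : MeasurePreserving (fun q : ℝ × ℝ => (q.2 + q.1 / 2, q.2 - q.1 / 2))
    (volume : Measure (ℝ × ℝ)) volume := by
  rw [Measure.volume_eq_prod]
  have s1 : MeasurePreserving (fun q : ℝ × ℝ => (q.1, q.2 - q.1 / 2)) ((volume : Measure ℝ).prod volume)
      ((volume : Measure ℝ).prod volume) := by
    refine (MeasurePreserving.id volume).skew_product (g := fun t z => z - t / 2) (by fun_prop) ?_
    exact Eventually.of_forall fun t => (measurePreserving_sub_right volume (t / 2)).map_eq
  have s2 : MeasurePreserving (fun q : ℝ × ℝ => (q.1, q.2 + q.1)) ((volume : Measure ℝ).prod volume)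
      ((volume : Measure ℝ).prod volume) := by
    refine (MeasurePreserving.id volume).skew_product (g := fun t z => z + t) (by fun_prop) ?_
    exact Eventually.of_forall fun t => (measurePreserving_add_right volume t).map_eq
  have sw := Measure.measurePreserving_swap (μ := (volume : Measure ℝ)) (ν := (volume : Measure ℝ))
  have := sw.comp (s2.comp (sw.comp s1))
  have e : (fun q : ℝ × ℝ => (q.2 + q.1 / 2, q.2 - q.1 / 2)) =
      Prod.swap ∘ (fun q : ℝ × ℝ => (q.1, q.2 + q.1)) ∘ Prod.swap ∘ fun q : ℝ × ℝ => (q.1, q.2 - q.1 / 2) := by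
    funext q
    refine Prod.ext ?_ ?_
    · change q.2 + q.1 / 2 = q.1 + (q.2 - q.1 / 2)
      ring
    · rfl
  rw [e]
  exact this

lemma pen_S (d : ℝ) (h k : ℝ → ℝ) (hc : Continuous h) (hi : Integrable h)
    (h0 : ∀ s ≤ d, h s = 0) (kc : Continuous k) :
    IntegrableOn (fun p : ℝ × ℝ => h (p.1 + p.2) * k (p.1 - p.2)) (pencil d) ∧
    ∫ p in pencil d, h (p.1 + p.2) * k (p.1 - p.2) = (1 / 2) * (∫ s, h s) * ∫ t in Icc (-d) d, k t := by
  set K := (Icc (-d) d).indicator k with hK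
  have hKi : Integrable K := by
    rw [hK, integrable_indicator_iff measurableSet_Icc]
    exact kc.continuousOn.integrableOn_compact isCompact_Icc
  have hind : (pencil d).indicator (fun p : ℝ × ℝ => h (p.1 + p.2) * k (p.1 - p.2)) =
      fun p => h (p.1 + p.2) * K (p.1 - p.2) := by
    ext ⟨x, y⟩
    by_cases hs : x + y ≤ d
    · simp [indicator, h0 _ hs]
    · by_cases ht : x - y ∈ Icc (-d) d
      · have : (x, y) ∈ pencil d := by
          refine ⟨?_, ?_, abs_le.2 ht⟩ <;> simp only [not_le] at * <;> linarith [ht.1, ht.2]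
        rw [indicator_of_mem this, hK, indicator_of_mem ht]
      · have : (x, y) ∉ pencil d := fun hp => ht (abs_le.1 hp.2.2)
        rw [indicator_of_notMem this, hK, indicator_of_notMem ht, mul_zero]
  have hm : AEStronglyMeasurable (fun p : ℝ × ℝ => h (p.1 + p.2) * K (p.1 - p.2)) volume := by
    have : Measurable K := kc.measurable.indicator measurableSet_Icc
    exact (by fun_prop : Measurable (fun p : ℝ × ℝ => h (p.1 + p.2) * K (p.1 - p.2))).aestronglyMeasurable
  have hcomp : (fun p : ℝ × ℝ => h (p.1 + p.2) * K (p.1 - p.2)) ∘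
      (fun q : ℝ × ℝ => (q.2 + q.1 / 2, q.2 - q.1 / 2)) = fun q => K q.1 * h (q.2 * 2) := by
    ext q; simp only [Function.comp]; rw [mul_comm]; congr 2 <;> ring
  have hi2 : Integrable (fun z => h (z * 2)) := hi.comp_mul_right' two_ne_zero
  constructor
  · rw [← integrable_indicator_iff (pencil_meas d), hind, ← pen_mp.integrable_comp hm, hcomp,
      Measure.volume_eq_prod]
    exact hKi.mul_prod hi2
  · rw [← integral_indicator (pencil_meas d), hind]
    conv_lhs => rw [← pen_mp.map_eq]
    rw [integral_map pen_mp.measurable.aemeasurable (by rw [pen_mp.map_eq]; exact hm)]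
    have := congrArg (fun F => ∫ q, F q) hcomp
    simp only [Function.comp] at this
    rw [this, Measure.volume_eq_prod, integral_prod_mul K (fun z => h (z * 2)), Measure.integral_comp_mul_right,
      hK, integral_indicator measurableSet_Icc, smul_eq_mul, abs_of_pos (by norm_num)]
    ring

lemma pen_weak (d : ℝ) (u : ℕ → ℝ × ℝ → ℂ) (hi : ∀ n, IntegrableOn (fun p => ‖u n p‖ ^ 2) (pencil d))
    (h1 : ∀ n, (∫ p in pencil d, ‖u n p‖ ^ 2) = 1)
    (h0 : ∀ (n : ℕ) (p : ℝ × ℝ), p.1 + p.2 < (n : ℝ) → u n p = 0)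
    (g : ℝ × ℝ → ℂ) (hg : IntegrableOn (fun p => ‖g p‖ ^ 2) (pencil d)) :
    Tendsto (fun n => ∫ p in pencil d, (starRingEnd ℂ) (g p) * u n p) atTop (nhds 0) := by
  let S : ℕ → Set (ℝ × ℝ) := fun n => {p | (n : ℝ) ≤ p.1 + p.2}
  have hS : ∀ n, MeasurableSet (S n) := fun n => measurableSet_le measurable_const (by fun_prop)
  have hGi : ∀ n, IntegrableOn ((S n).indicator fun p => ‖g p‖ ^ 2) (pencil d) := fun n =>
    Integrable.indicator hg (hS n)
  have hG : Tendsto (fun n => ∫ p in pencil d, (S n).indicator (fun p => ‖g p‖ ^ 2) p) atTop (nhds 0) := by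
    have := tendsto_integral_of_dominated_convergence (μ := volume.restrict (pencil d))
      (F := fun n p => (S n).indicator (fun p => ‖g p‖ ^ 2) p) (f := fun _ => 0)
      (fun p => ‖g p‖ ^ 2) (fun n => (hGi n).aestronglyMeasurable) hg
      (fun n => Eventually.of_forall fun p => by
        rw [Real.norm_eq_abs, abs_of_nonneg (indicator_nonneg (fun p _ => sq_nonneg _) p)]
        exact indicator_le_self' (fun _ _ => sq_nonneg _) p)
      (Eventually.of_forall fun p => by
        apply tendsto_const_nhds.congr'
        obtain ⟨m, hm⟩ := exists_nat_gt (p.1 + p.2)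
        filter_upwards [eventually_ge_atTop m] with n hn
        have : p ∉ S n := by
          have : (m : ℝ) ≤ n := by exact_mod_cast hn
          simp only [S, mem_ofPred_eq, not_le]; linarith
        rw [indicator_of_notMem this])
    simpa using this
  rw [Metric.tendsto_atTop]
  intro ε hε
  have ev := hG.eventually (gt_mem_nhds (by positivity : 0 < ε ^ 2))
  obtain ⟨N, hN⟩ := eventually_atTop.1 ev
  refine ⟨N, fun n hn => ?_⟩
  rw [dist_zero_right]
  refine (norm_integral_le_integral_norm _).trans_lt ?_
  have b : ∫ p in pencil d, ‖(starRingEnd ℂ) (g p) * u n p‖ ≤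
      ∫ p in pencil d, (1 / (2 * ε) * (S n).indicator (fun p => ‖g p‖ ^ 2) p + ε / 2 * ‖u n p‖ ^ 2) := by
    apply integral_mono_of_nonneg (Eventually.of_forall fun p => norm_nonneg _)
      (((hGi n).const_mul _).add ((hi n).const_mul _))
    refine Eventually.of_forall fun p => ?_
    simp only [norm_mul, RCLike.norm_conj, Pi.add_apply]
    by_cases hp : p ∈ S n
    · rw [indicator_of_mem hp]
      have e : 1 / (2 * ε) * ‖g p‖ ^ 2 + ε / 2 * ‖u n p‖ ^ 2 - ‖g p‖ * ‖u n p‖ =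
        (‖g p‖ - ε * ‖u n p‖) ^ 2 / (2 * ε) := by field_simp; ring
      have : 0 ≤ (‖g p‖ - ε * ‖u n p‖) ^ 2 / (2 * ε) := by positivity
      linarith
    · rw [indicator_of_notMem hp, h0 n p (by simpa [S] using hp)]; simp
  refine b.trans_lt ?_
  rw [integral_add ((hGi n).const_mul _) ((hi n).const_mul _), integral_const_mul, integral_const_mul, h1]
  have h3 := hN n hn
  have h4 : 1 / (2 * ε) * (∫ p in pencil d, (S n).indicator (fun p => ‖g p‖ ^ 2) p) < 1 / (2 * ε) * ε ^ 2 :=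
    mul_lt_mul_of_pos_left h3 (by positivity)
  have h5 : 1 / (2 * ε) * ε ^ 2 = ε / 2 := by field_simp
  linarith

lemma pen_lap (f f' f'' : ℝ → ℂ) (κ : ℝ) (h1 : ∀ t, HasDerivAt f (f' t) t)
    (h2 : ∀ t, HasDerivAt f' (f'' t) t) (p : ℝ × ℝ) :
    lap2 (fun p => f (p.1 + p.2) * (cos (κ * (p.1 - p.2)) : ℂ)) p =
      2 * (f'' (p.1 + p.2) - κ ^ 2 * f (p.1 + p.2)) * (cos (κ * (p.1 - p.2)) : ℂ) := by
  obtain ⟨x, y⟩ := p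
  simp only [lap2]
  have comp : ∀ (g g' : ℝ → ℂ), (∀ t, HasDerivAt g (g' t) t) → ∀ c t : ℝ,
      HasDerivAt (fun t => g (t + c)) (g' (t + c)) t := fun g g' hg c t => (hg (t + c)).comp_add_const t c
  have comp' : ∀ (g g' : ℝ → ℂ), (∀ t, HasDerivAt g (g' t) t) → ∀ c t : ℝ,
      HasDerivAt (fun t => g (c + t)) (g' (c + t)) t := fun g g' hg c t => (hg (c + t)).comp_const_add c t
  have lin : ∀ c t : ℝ, HasDerivAt (fun t => κ * (t - c)) κ t := fun c t => by
    simpa using ((hasDerivAt_id t).sub_const c).const_mul κ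
  have lin' : ∀ c t : ℝ, HasDerivAt (fun t => κ * (c - t)) (-κ) t := fun c t => by
    simpa using ((hasDerivAt_id t).const_sub c).const_mul κ
  have C : ∀ c t : ℝ, HasDerivAt (fun t => (cos (κ * (t - c)) : ℂ)) (-κ * sin (κ * (t - c)) : ℂ) t := by
    intro c t
    exact ((lin c t).cos.ofReal_comp).congr_deriv (by push_cast; ring)
  have S : ∀ c t : ℝ, HasDerivAt (fun t => (sin (κ * (t - c)) : ℂ)) (κ * cos (κ * (t - c)) : ℂ) t := by
    intro c t
    exact ((lin c t).sin.ofReal_comp).congr_deriv (by push_cast; ring)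
  have C' : ∀ c t : ℝ, HasDerivAt (fun t => (cos (κ * (c - t)) : ℂ)) (κ * sin (κ * (c - t)) : ℂ) t := by
    intro c t
    exact ((lin' c t).cos.ofReal_comp).congr_deriv (by push_cast; ring)
  have S' : ∀ c t : ℝ, HasDerivAt (fun t => (sin (κ * (c - t)) : ℂ)) (-κ * cos (κ * (c - t)) : ℂ) t := by
    intro c t
    exact ((lin' c t).sin.ofReal_comp).congr_deriv (by push_cast; ring)
  have e1 : (deriv fun t => f (t + y) * (cos (κ * (t - y)) : ℂ)) = fun t =>
      f' (t + y) * (cos (κ * (t - y)) : ℂ) + f (t + y) * (-κ * sin (κ * (t - y)) : ℂ) := by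
    ext t; exact ((comp f f' h1 y t).mul (C y t)).deriv
  have e2 : (deriv fun t => f (x + t) * (cos (κ * (x - t)) : ℂ)) = fun t =>
      f' (x + t) * (cos (κ * (x - t)) : ℂ) + f (x + t) * (κ * sin (κ * (x - t)) : ℂ) := by
    ext t; exact ((comp' f f' h1 x t).mul (C' x t)).deriv
  have d1 := (((comp f' f'' h2 y x).mul (C y x)).add ((comp f f' h1 y x).mul ((S y x).const_mul (-κ : ℂ)))).deriv
  have d2 := (((comp' f' f'' h2 x y).mul (C' x y)).add ((comp' f f' h1 x y).mul ((S' x y).const_mul (κ : ℂ)))).deriv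
  rw [e1, e2]
  refine (congrArg₂ (· + ·) d1 d2).trans ?_
  ring

lemma pen_bump : ∃ X X' X'' : ℝ → ℝ, ContDiff ℝ 2 X ∧ Continuous X ∧ Continuous X' ∧ Continuous X'' ∧
    (∀ t, HasDerivAt X (X' t) t) ∧ (∀ t, HasDerivAt X' (X'' t) t) ∧
    (∀ t, 2 < |t| → X t = 0 ∧ X' t = 0 ∧ X'' t = 0) ∧ 0 < ∫ t, X t ^ 2 := by
  let B : ContDiffBump (0 : ℝ) := ⟨1, 2, one_pos, one_lt_two⟩
  have hB : ContDiff ℝ 2 B := B.contDiff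
  have hB1 : ContDiff ℝ 1 (deriv B) := by
    have : ContDiff ℝ (1 + 1) B := by simpa [one_add_one_eq_two] using hB
    exact (contDiff_succ_iff_deriv.1 this).2.2
  have z0 : ∀ t : ℝ, 2 < |t| → B t = 0 := fun t ht =>
    B.zero_of_le_dist (by simpa [B, Real.dist_eq] using ht.le)
  have op : IsOpen {t : ℝ | 2 < |t|} := isOpen_lt continuous_const continuous_abs
  have zd : ∀ (G : ℝ → ℝ), (∀ t : ℝ, 2 < |t| → G t = 0) → ∀ t : ℝ, 2 < |t| → deriv G t = 0 := by
    intro G hG t ht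
    have : G =ᶠ[nhds t] fun _ => 0 := by
      filter_upwards [op.mem_nhds ht] with s hs using hG s hs
    rw [this.deriv_eq]; simp
  refine ⟨B, deriv B, deriv (deriv B), hB, hB.continuous, hB1.continuous,
    hB1.continuous_deriv le_rfl, fun t => ((hB.differentiable (by norm_num)) t).hasDerivAt,
    fun t => ((hB1.differentiable (by norm_num)) t).hasDerivAt,
    fun t ht => ⟨z0 t ht, zd _ z0 t ht, zd _ (zd _ z0) t ht⟩, ?_⟩
  have hc : Continuous (fun t => B t ^ 2) := hB.continuous.pow 2
  refine hc.integral_pos_of_hasCompactSupport_nonneg_nonzero (x := 0) ?_ (fun t => sq_nonneg _) ?_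
  · refine HasCompactSupport.intro (isCompact_closedBall (0 : ℝ) 2) fun t ht => ?_
    have : 2 < |t| := by simpa [Real.dist_eq] using ht
    simp [z0 t this]
  · have : B 0 = 1 := B.one_of_mem_closedBall (by simp [B])
    simp [this]

lemma pen_cont (h : ℝ → ℂ) (hc : Continuous h) (L R : ℝ) (hz : ∀ s, s < L ∨ R < s → h s = 0) :
    Continuous (fun s => ‖h s‖ ^ 2) ∧ Integrable (fun s => ‖h s‖ ^ 2) := by
  have c : Continuous (fun s => ‖h s‖ ^ 2) := by fun_prop
  refine ⟨c, c.integrable_of_hasCompactSupport ?_⟩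
  refine HasCompactSupport.intro (isCompact_Icc (a := L) (b := R)) fun t ht => ?_
  have : t < L ∨ R < t := by
    by_contra hh
    push Not at hh
    exact ht ⟨hh.1, hh.2⟩
  simp [hz t this]

lemma pen_LL (d κ : ℝ) (h : ℝ → ℂ) (hc : Continuous h) (L R : ℝ) (hL : d < L)
    (hz : ∀ s, s < L ∨ R < s → h s = 0) :
    IntegrableOn (fun p : ℝ × ℝ => ‖h (p.1 + p.2) * (cos (κ * (p.1 - p.2)) : ℂ)‖ ^ 2) (pencil d) ∧
    ∫ p in pencil d, ‖h (p.1 + p.2) * (cos (κ * (p.1 - p.2)) : ℂ)‖ ^ 2 =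
      (1 / 2) * (∫ s, ‖h s‖ ^ 2) * ∫ t in Icc (-d) d, cos (κ * t) ^ 2 := by
  have := pen_cont h hc L R hz
  have e : (fun p : ℝ × ℝ => ‖h (p.1 + p.2) * (cos (κ * (p.1 - p.2)) : ℂ)‖ ^ 2) =
      fun p => ‖h (p.1 + p.2)‖ ^ 2 * cos (κ * (p.1 - p.2)) ^ 2 := by
    ext p
    rw [norm_mul, mul_pow, Complex.norm_real, Real.norm_eq_abs, sq_abs]
  rw [e]
  exact pen_S d (fun s => ‖h s‖ ^ 2) (fun t => cos (κ * t) ^ 2) this.1 this.2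
    (fun s hs => by simp [hz s (Or.inl (hs.trans_lt hL))]) (by fun_prop)

lemma pen_dom (d : ℝ) (hd : 0 < d) (f f' f'' : ℝ → ℂ) (h1 : ∀ t, HasDerivAt f (f' t) t)
    (h2 : ∀ t, HasDerivAt f' (f'' t) t) (hs : ContDiff ℝ 2 f) (hc : Continuous f'') (L R : ℝ) (hL : d < L)
    (hz : ∀ s, s < L ∨ R < s → f s = 0) (hz2 : ∀ s, s < L ∨ R < s → f'' s = 0) :
    PencilDom d (fun p => f (p.1 + p.2) * (cos (π / (2 * d) * (p.1 - p.2)) : ℂ)) := by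
  have hfc := hs.continuous
  refine ⟨?_, ?_, ?_, ?_, ?_, ?_⟩
  · have a : ContDiff ℝ 2 (fun p : ℝ × ℝ => f (p.1 + p.2)) := hs.comp (by fun_prop)
    have b : ContDiff ℝ 2 (fun p : ℝ × ℝ => cos (π / (2 * d) * (p.1 - p.2))) :=
      Real.contDiff_cos.comp (by fun_prop)
    have c : ContDiff ℝ 2 (fun p : ℝ × ℝ => ((cos (π / (2 * d) * (p.1 - p.2)) : ℝ) : ℂ)) :=
      Complex.ofRealCLM.contDiff.comp b
    exact a.mul c
  · intro p hp h
    have : cos (π / (2 * d) * (p.1 - p.2)) = 0 := by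
      rw [← Real.cos_abs, abs_mul, h, abs_of_pos (by positivity)]
      rw [show π / (2 * d) * d = π / 2 by field_simp, Real.cos_pi_div_two]
    simp only [this, Complex.ofReal_zero, mul_zero]
  · intro y hy
    have : (fun t : ℝ => f (t + y) * (cos (π / (2 * d) * (t - y)) : ℂ)) =ᶠ[nhds 0] fun _ => 0 := by
      filter_upwards [gt_mem_nhds (sub_pos.2 hL)] with t ht
      rw [hz _ (Or.inl (by linarith [hy.2])), zero_mul]
    rw [this.deriv_eq]; simp
  · intro y hy
    have : (fun t : ℝ => f (y + t) * (cos (π / (2 * d) * (y - t)) : ℂ)) =ᶠ[nhds 0] fun _ => 0 := by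
      filter_upwards [gt_mem_nhds (sub_pos.2 hL)] with t ht
      rw [hz _ (Or.inl (by linarith [hy.2])), zero_mul]
    rw [this.deriv_eq]; simp
  · exact (pen_LL d (π / (2 * d)) f hfc L R hL hz).1
  · have e : lap2 (fun p => f (p.1 + p.2) * (cos (π / (2 * d) * (p.1 - p.2)) : ℂ)) = fun p =>
        (fun s => 2 * (f'' s - (π / (2 * d) : ℝ) ^ 2 * f s)) (p.1 + p.2) * (cos (π / (2 * d) * (p.1 - p.2)) : ℂ) := by
      ext p
      exact pen_lap f f' f'' (π / (2 * d)) h1 h2 p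
    rw [e]
    exact (pen_LL d (π / (2 * d)) (fun s => 2 * (f'' s - (π / (2 * d) : ℝ) ^ 2 * f s)) (by fun_prop) L R hL
      (fun s hs => by simp [hz s hs, hz2 s hs])).1

lemma pen_deriv (P P' Q Q' : ℝ → ℝ) (hP : ∀ t, HasDerivAt P (P' t) t) (hQ : ∀ t, HasDerivAt Q (Q' t) t)
    (a N k s : ℝ) :
    HasDerivAt (fun s : ℝ => ((P ((s - a) / N) : ℂ) + (Q ((s - a) / N) : ℂ) * Complex.I) *
        Complex.exp (((k * s : ℝ) : ℂ) * Complex.I))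
      ((((P' ((s - a) / N) / N - k * Q ((s - a) / N) : ℝ) : ℂ) +
        ((Q' ((s - a) / N) / N + k * P ((s - a) / N) : ℝ) : ℂ) * Complex.I) *
        Complex.exp (((k * s : ℝ) : ℂ) * Complex.I)) s := by
  have l : HasDerivAt (fun s : ℝ => (s - a) / N) (1 / N) s :=
    ((hasDerivAt_id s).sub_const a).div_const N
  have p := ((hP ((s - a) / N)).comp s l).ofReal_comp
  have q := ((hQ ((s - a) / N)).comp s l).ofReal_comp
  have e0 : HasDerivAt (fun s : ℝ => k * s) k s := by simpa using (hasDerivAt_id s).const_mul k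
  have e := (e0.ofReal_comp.mul_const Complex.I).cexp
  refine ((p.add (q.mul_const Complex.I)).mul e).congr_deriv ?_
  simp only [Function.comp, Pi.add_apply]
  push_cast
  have := Complex.I_sq
  linear_combination (Q ((s - a) / N) : ℂ) * k * Complex.exp (k * s * Complex.I) * this

lemma pen_nsq (A B t : ℝ) :
    ‖((A : ℂ) + (B : ℂ) * Complex.I) * Complex.exp ((t : ℂ) * Complex.I)‖ ^ 2 = A ^ 2 + B ^ 2 := by
  rw [norm_mul, Complex.norm_exp_ofReal_mul_I, mul_one, ← Complex.normSq_eq_norm_sq, Complex.normSq_add_mul_I]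

lemma pen_scale (G : ℝ → ℝ) (a N : ℝ) (hN : 0 < N) :
    ∫ s, G ((s - a) / N) = N * ∫ t, G t := by
  have h := integral_sub_right_eq_self (μ := volume) (fun s => G (s / N)) a
  rw [h, Measure.integral_comp_div, abs_of_pos hN, smul_eq_mul]

lemma pen_sup (d : ℝ) (hd : 0 < d) (μ : ℝ) (hμ : π ^ 2 / (2 * d ^ 2) ≤ μ) : InPencilEssSpec d μ := by
  obtain ⟨X, X', X'', Xs, Xc, Xc', Xc'', D1, D2, Xz, X0⟩ := pen_bump
  set κ := π / (2 * d) with hκ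
  obtain ⟨k, hk⟩ : ∃ k : ℝ, μ = 2 * κ ^ 2 + 2 * k ^ 2 := by
    have h2 : 2 * κ ^ 2 = π ^ 2 / (2 * d ^ 2) := by rw [hκ]; field_simp
    refine ⟨√((μ - π ^ 2 / (2 * d ^ 2)) / 2), ?_⟩
    rw [Real.sq_sqrt (by linarith), h2]; ring
  set D := ∫ t in Icc (-d) d, cos (κ * t) ^ 2 with hD
  have Dpos : 0 < D := by
    rw [hD, integral_Icc_eq_integral_Ioc, ← intervalIntegral.integral_of_le (by linarith)]
    refine intervalIntegral.intervalIntegral_pos_of_pos_on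
      ((by fun_prop : Continuous fun t => cos (κ * t) ^ 2).intervalIntegrable _ _) ?_ (by linarith)
    intro t ht
    have e : κ * d = π / 2 := by rw [hκ]; field_simp
    have kp : 0 < κ := by positivity
    have : 0 < cos (κ * t) := by
      apply cos_pos_of_mem_Ioo
      constructor <;> nlinarith [ht.1, ht.2]
    positivity
  set A := ∫ t, X t ^ 2 with hA
  let N : ℕ → ℝ := fun n => n + 1
  have Np : ∀ n, 0 < N n := fun n => by positivity
  let a : ℕ → ℝ := fun n => 3 * N n + d + 1
  let c : ℕ → ℝ := fun n => √(2 / (N n * A * D))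
  have c2 : ∀ n, c n ^ 2 = 2 / (N n * A * D) := fun n => Real.sq_sqrt (by have := Np n; positivity)
  let E : ℕ → ℝ → ℂ := fun n s => Complex.exp (((k * s : ℝ) : ℂ) * Complex.I)
  let f : ℕ → ℝ → ℂ := fun n s => (((c n * X ((s - a n) / N n) : ℝ) : ℂ) + ((0 : ℝ) : ℂ) * Complex.I) * E n s
  let f1 : ℕ → ℝ → ℂ := fun n s => (((c n * X' ((s - a n) / N n) / N n : ℝ) : ℂ) +
    ((k * (c n * X ((s - a n) / N n)) : ℝ) : ℂ) * Complex.I) * E n s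
  let f2 : ℕ → ℝ → ℂ := fun n s =>
    (((c n * X'' ((s - a n) / N n) / N n / N n - k * (k * (c n * X ((s - a n) / N n))) : ℝ) : ℂ) +
    ((k * (c n * X' ((s - a n) / N n)) / N n + k * (c n * X' ((s - a n) / N n) / N n) : ℝ) : ℂ) * Complex.I) * E n s
  have Fd : ∀ n s, HasDerivAt (f n) (f1 n s) s := by
    intro n s
    have := pen_deriv (fun t => c n * X t) (fun t => c n * X' t) (fun _ => 0) (fun _ => 0)
      (fun t => (D1 t).const_mul _) (fun t => hasDerivAt_const t 0) (a n) (N n) k s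
    simpa [f, f1, E] using this
  have Fd1 : ∀ n s, HasDerivAt (f1 n) (f2 n s) s := by
    intro n s
    exact pen_deriv (fun t => c n * X' t / N n) (fun t => c n * X'' t / N n)
      (fun t => k * (c n * X t)) (fun t => k * (c n * X' t))
      (fun t => ((D2 t).const_mul _).div_const _) (fun t => ((D1 t).const_mul _).const_mul _) (a n) (N n) k s
  have Ec : ∀ n, Continuous (E n) := fun n => by fun_prop
  have Fs : ∀ n, ContDiff ℝ 2 (f n) := by
    intro n
    have h1 : ContDiff ℝ 2 (fun s => c n * X ((s - a n) / N n)) :=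
      contDiff_const.mul (Xs.comp (by fun_prop))
    have h2 : ContDiff ℝ 2 (fun s => ((c n * X ((s - a n) / N n) : ℝ) : ℂ)) :=
      Complex.ofRealCLM.contDiff.comp h1
    have h3 : ContDiff ℝ 2 (fun s : ℝ => ((k * s : ℝ) : ℂ)) :=
      Complex.ofRealCLM.contDiff.comp (contDiff_const.mul contDiff_id)
    exact (h2.add contDiff_const).mul ((h3.mul contDiff_const).cexp)
  have F2c : ∀ n, Continuous (f2 n) := by
    intro n
    have := Ec n
    fun_prop
  have zt : ∀ n s, s < N n + d + 1 ∨ 5 * N n + d + 1 < s → 2 < |(s - a n) / N n| := by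
    intro n s hs
    rw [abs_div, abs_of_pos (Np n), lt_div_iff₀ (Np n), lt_abs]
    simp only [a]
    rcases hs with h | h
    · right; linarith
    · left; linarith
  have Fz : ∀ n s, s < N n + d + 1 ∨ 5 * N n + d + 1 < s → f n s = 0 := by
    intro n s hs
    simp [f, (Xz _ (zt n s hs)).1]
  have Fz2 : ∀ n s, s < N n + d + 1 ∨ 5 * N n + d + 1 < s → f2 n s = 0 := by
    intro n s hs
    obtain ⟨h1, h2, h3⟩ := Xz _ (zt n s hs)
    simp [f2, h1, h2, h3]
  have hL : ∀ n, d < N n + d + 1 := fun n => by linarith [Np n]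
  have Dom : ∀ n, PencilDom d (fun p => f n (p.1 + p.2) * (cos (κ * (p.1 - p.2)) : ℂ)) := fun n =>
    pen_dom d hd (f n) (f1 n) (f2 n) (Fd n) (Fd1 n) (Fs n) (F2c n) _ _ (hL n) (Fz n) (Fz2 n)
  have h1 : ∀ n, (∫ p in pencil d, ‖f n (p.1 + p.2) * (cos (κ * (p.1 - p.2)) : ℂ)‖ ^ 2) = 1 := by
    intro n
    rw [(pen_LL d κ (f n) (Fs n).continuous _ _ (hL n) (Fz n)).2, ← hD]
    have e : ∀ s, ‖f n s‖ ^ 2 = (fun t => c n ^ 2 * X t ^ 2) ((s - a n) / N n) := by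
      intro s
      simp only [f, E]
      rw [pen_nsq]; ring
    simp_rw [e]
    rw [pen_scale (fun t => c n ^ 2 * X t ^ 2) _ _ (Np n), integral_const_mul, ← hA, c2]
    have := Np n
    field_simp
  refine ⟨fun n p => f n (p.1 + p.2) * (cos (κ * (p.1 - p.2)) : ℂ), Dom, h1, ?_, ?_⟩
  · intro g hg
    refine pen_weak d _ (fun n => (Dom n).l2) h1 ?_ g hg
    intro n p hp
    rw [Fz n _ (Or.inl (by simp only [N]; linarith)), zero_mul]
  · set B1 := ∫ t, X' t ^ 2 with hB1
    set B2 := ∫ t, X'' t ^ 2 with hB2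
    have cs : ∀ G : ℝ → ℝ, Continuous G → (∀ t, 2 < |t| → G t = 0) → Integrable (fun t => G t ^ 2) := by
      intro G hG hz
      refine (hG.pow 2).integrable_of_hasCompactSupport ?_
      refine HasCompactSupport.intro (isCompact_closedBall (0 : ℝ) 2) fun t ht => ?_
      have : 2 < |t| := by simpa [Real.dist_eq] using ht
      simp [hz t this]
    have val : ∀ n, (∫ p in pencil d, ‖lap2 (fun p => f n (p.1 + p.2) * (cos (κ * (p.1 - p.2)) : ℂ)) p +
        (μ : ℂ) * (f n (p.1 + p.2) * (cos (κ * (p.1 - p.2)) : ℂ))‖ ^ 2) =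
        4 / A * (B2 * (1 / N n) ^ 4 + 4 * k ^ 2 * B1 * (1 / N n) ^ 2) := by
      intro n
      have e : ∀ p : ℝ × ℝ, lap2 (fun p => f n (p.1 + p.2) * (cos (κ * (p.1 - p.2)) : ℂ)) p +
          (μ : ℂ) * (f n (p.1 + p.2) * (cos (κ * (p.1 - p.2)) : ℂ)) =
          (fun s => 2 * (f2 n s + (k : ℂ) ^ 2 * f n s)) (p.1 + p.2) * (cos (κ * (p.1 - p.2)) : ℂ) := by
        intro p
        rw [pen_lap (f n) (f1 n) (f2 n) κ (Fd n) (Fd1 n) p, hk]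
        push_cast
        ring
      have fc := (Fs n).continuous
      have f2c := F2c n
      simp_rw [e]
      rw [(pen_LL d κ (fun s => 2 * (f2 n s + (k : ℂ) ^ 2 * f n s)) (by fun_prop) _ (5 * N n + d + 1) (hL n)
        (fun s hs => by simp [Fz n s hs, Fz2 n s hs])).2, ← hD]
      have e2 : ∀ s, ‖2 * (f2 n s + (k : ℂ) ^ 2 * f n s)‖ ^ 2 =
          (fun t => 4 * c n ^ 2 * (1 / N n) ^ 4 * X'' t ^ 2 + 16 * k ^ 2 * c n ^ 2 * (1 / N n) ^ 2 * X' t ^ 2)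
            ((s - a n) / N n) := by
        intro s
        have e3 : 2 * (f2 n s + (k : ℂ) ^ 2 * f n s) =
            (((2 * c n * (1 / N n) ^ 2 * X'' ((s - a n) / N n) : ℝ) : ℂ) +
              ((4 * k * c n * (1 / N n) * X' ((s - a n) / N n) : ℝ) : ℂ) * Complex.I) *
              Complex.exp (((k * s : ℝ) : ℂ) * Complex.I) := by
          simp only [f2, f, E]
          push_cast
          ring
        rw [e3, pen_nsq]; ring
      simp_rw [e2]
      rw [pen_scale (fun t => 4 * c n ^ 2 * (1 / N n) ^ 4 * X'' t ^ 2 +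
          16 * k ^ 2 * c n ^ 2 * (1 / N n) ^ 2 * X' t ^ 2) _ _ (Np n),
        integral_add ((cs X'' Xc'' fun t ht => (Xz t ht).2.2).const_mul _)
          ((cs X' Xc' fun t ht => (Xz t ht).2.1).const_mul _),
        integral_const_mul, integral_const_mul, ← hB1, ← hB2, c2]
      have := Np n
      field_simp
      ring
    simp_rw [val]
    have t0 : Tendsto (fun n => 1 / N n) atTop (nhds 0) := tendsto_one_div_add_atTop_nhds_zero_nat
    have := ((((t0.pow 4).const_mul B2).add ((t0.pow 2).const_mul (4 * k ^ 2 * B1))).const_mul (4 / A))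
    simpa using this

/-- For the Laplacian on the pencil domain with Dirichlet conditions on
`{|x-y| = d}` (and Neumann conditions on the axes): `[2π²/d², ∞)` is contained
in the essential spectrum, and in fact `σ_ess(-Δ₀^d) = [π²/(2d²), ∞)`. -/
theorem pencilEssentialSpectrum (d : ℝ) (hd : 0 < d) :
    Ici (2 * π ^ 2 / d ^ 2) ⊆ {μ | InPencilEssSpec d μ} ∧
    {μ | InPencilEssSpec d μ} = Ici (π ^ 2 / (2 * d ^ 2)) := by
  constructor
  · intro μ hμ
    refine pen_sup d hd μ (le_trans ?_ (mem_Ici.1 hμ))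
    rw [div_le_div_iff₀ (by positivity) (by positivity)]
    have : 0 < π ^ 2 * d ^ 2 := by positivity
    nlinarith
  · ext μ
    exact ⟨fun h => pen_sub d hd μ h, fun h => pen_sup d hd μ h⟩
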